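/- arXiv:2304.03046 — 2 statements merged into one kernel-verified Lean document; each statement's English description precedes it below -/
import Mathlib

section
/- Let F_ℓ = P_{k_1} ∪ ⋯ ∪ P_{k_ℓ} be a linear forest with ℓ ≥ 1, k_1 ≥ ⋯ ≥ k_ℓ ≥ 2, and p = (∑_{i=1}^{ℓ} ⌊k_i/2⌋) − 1 ≥ 1, and suppose at least one k_i is even. Let α ∈ (0,1). Then there exists N such that for all n ≥ N, every F_ℓ-free simple graph G on n vertices satisfies ρ_α(G) ≤ (αn + p − 1 + √((αn + p − 1)² − 4p(2α − 1)n − 4p(p − (p+1)α)))/2, with equality if and only if G is isomorphic to S_{n,p}. -/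
open SimpleGraph
open scoped Classical

/-- The largest element of the real spectrum of a real matrix (for a real symmetric
matrix this is the largest eigenvalue). -/
noncomputable def specRad {n : ℕ} (M : Matrix (Fin n) (Fin n) ℝ) : ℝ :=
  sSup (spectrum ℝ M)

/-- The diagonal degree matrix of a simple graph on `Fin n`. -/
noncomputable def degMat {n : ℕ} (G : SimpleGraph (Fin n)) : Matrix (Fin n) (Fin n) ℝ :=
  Matrix.diagonal fun i => (Nat.card {j // G.Adj i j} : ℝ)

/-- The adjacency matrix (over `ℝ`) of a simple graph on `Fin n`. -/
noncomputable def adjMat {n : ℕ} (G : SimpleGraph (Fin n)) : Matrix (Fin n) (Fin n) ℝ :=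
  Matrix.of fun i j => if G.Adj i j then (1 : ℝ) else 0

/-- The `A_α`-spectral radius of a graph: largest eigenvalue of `α D + (1-α) A`. -/
noncomputable def rhoAlpha (α : ℝ) {n : ℕ} (G : SimpleGraph (Fin n)) : ℝ :=
  specRad (α • degMat G + (1 - α) • adjMat G)

/-- The signless Laplacian spectral radius of a graph: largest eigenvalue of `D + A`. -/
noncomputable def qRad {n : ℕ} (G : SimpleGraph (Fin n)) : ℝ :=
  specRad (degMat G + adjMat G)

/-- `G` contains a subgraph isomorphic to the linear forest `⋃ i, P_{k i}`:
there are vertex-disjoint copies of the paths `P_{k i}` in `G`. -/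
def ContainsLinearForest {V : Type*} (G : SimpleGraph V) {ℓ : ℕ} (k : Fin ℓ → ℕ) : Prop :=
  ∃ f : (i : Fin ℓ) → Fin (k i) → V,
    (Function.Injective fun q : (i : Fin ℓ) × Fin (k i) => f q.1 q.2) ∧
    ∀ (i : Fin ℓ) (a b : Fin (k i)),
      (SimpleGraph.pathGraph (k i)).Adj a b → G.Adj (f i a) (f i b)

/-- `G` contains a subgraph isomorphic to `H`. -/
def Contains {V W : Type*} (G : SimpleGraph V) (H : SimpleGraph W) : Prop :=
  ∃ f : W ↪ V, ∀ a b, H.Adj a b → G.Adj (f a) (f b)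

/-- `S_{n,p} = K_p ∇ (empty graph on n-p vertices)`, realized on `Fin n` with the
first `p` vertices forming the dominating clique. -/
def Snp (n p : ℕ) : SimpleGraph (Fin n) :=
  SimpleGraph.fromRel fun i j => i.val < p ∨ j.val < p

/-- `S⁺_{n,p} = K_p ∇ (empty graph on n-p-2 vertices ∪ K_2)`, realized on `Fin n` with the
first `p` vertices forming the dominating clique and the last two vertices adjacent. -/
def SnpPlus (n p : ℕ) : SimpleGraph (Fin n) :=
  SimpleGraph.fromRel fun i j =>
    i.val < p ∨ j.val < p ∨ (n - 2 ≤ i.val ∧ n - 2 ≤ j.val)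

/-- `F_{n,p} = K_p ∇ (t K_2 ∪ r K_1)` where `n - p = 2t + r`, `0 ≤ r < 2`, realized on
`Fin n`: the first `p` vertices form the dominating clique and the remaining vertices
are paired into `t` independent edges (plus possibly one isolated vertex). -/
def Fnp (n p : ℕ) : SimpleGraph (Fin n) :=
  SimpleGraph.fromRel fun i j =>
    i.val < p ∨ j.val < p ∨
      (p ≤ i.val ∧ p ≤ j.val ∧ i.val < p + 2 * ((n - p) / 2) ∧
        j.val < p + 2 * ((n - p) / 2) ∧ (i.val - p) / 2 = (j.val - p) / 2)

/-- The disjoint union of cliques of size `c` on `Fin n` (blocks of consecutive vertices). -/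
def unionCliques (n c : ℕ) : SimpleGraph (Fin n) :=
  SimpleGraph.fromRel fun i j => i.val / c = j.val / c

/-- `K_c ∪ M_{n-c}` on `Fin n`: the first `c` vertices form a clique, the remaining
vertices induce a maximal matching `M_{n-c}` (plus possibly one isolated vertex). -/
def KcupM (n c : ℕ) : SimpleGraph (Fin n) :=
  SimpleGraph.fromRel fun i j =>
    (i.val < c ∧ j.val < c) ∨
      (c ≤ i.val ∧ c ≤ j.val ∧ i.val < c + 2 * ((n - c) / 2) ∧
        j.val < c + 2 * ((n - c) / 2) ∧ (i.val - c) / 2 = (j.val - c) / 2)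

/-- The cubic polynomial `f` from the paper. -/
noncomputable def fpoly (α : ℝ) (n p : ℕ) (x : ℝ) : ℝ :=
  x ^ 3 - ((p : ℝ) + (n : ℝ) * α + (p : ℝ) * α) * x ^ 2 +
    ((p : ℝ) - (n : ℝ) * (p : ℝ) + (n : ℝ) * α - 2 * (p : ℝ) * α + (p : ℝ) ^ 2 +
      (n : ℝ) * (p : ℝ) * α ^ 2 + 2 * (n : ℝ) * (p : ℝ) * α - 1) * x +
    (p : ℝ) ^ 2 * α ^ 2 - 2 * (p : ℝ) + (p : ℝ) ^ 3 * α ^ 2 + (n : ℝ) * (p : ℝ) +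
    5 * (p : ℝ) * α - 2 * α ^ 2 + (p : ℝ) ^ 2 * α - (p : ℝ) ^ 3 * α - (p : ℝ) ^ 2 +
    (n : ℝ) * (p : ℝ) ^ 2 * α - 2 * (n : ℝ) * (p : ℝ) ^ 2 * α ^ 2 -
    2 * (n : ℝ) * (p : ℝ) * α

/-- The cubic polynomial `g` from the paper. -/
noncomputable def gpoly (n p : ℕ) (x : ℝ) : ℝ :=
  x ^ 3 - ((n : ℝ) + 3 * (p : ℝ)) * x ^ 2 +
    (4 * (p : ℝ) ^ 2 + (n : ℝ) * (p : ℝ) + 2 * (n : ℝ) - 4) * x -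
    2 * (p : ℝ) ^ 2 * ((p : ℝ) + 1)

namespace AlphaSpectral

/-- The matrix `A_α(G) = α D(G) + (1 - α) A(G)`. -/
noncomputable abbrev alphaMat (α : ℝ) {n : ℕ} (G : SimpleGraph (Fin n)) :
    Matrix (Fin n) (Fin n) ℝ :=
  α • degMat G + (1 - α) • adjMat G

lemma posSemidef_specRad_sub {n : ℕ} {M : Matrix (Fin n) (Fin n) ℝ} (hM : M.IsHermitian) :
    (algebraMap ℝ (Matrix (Fin n) (Fin n) ℝ) (specRad M) - M).PosSemidef := by
  have hH : (algebraMap ℝ (Matrix (Fin n) (Fin n) ℝ) (specRad M) - M).IsHermitian := by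
    refine Matrix.IsHermitian.sub ?_ hM
    rw [Matrix.algebraMap_eq_diagonal]
    exact Matrix.isHermitian_diagonal _
  rw [hH.posSemidef_iff_eigenvalues_nonneg]
  intro i
  have h := hH.eigenvalues_mem_spectrum_real i
  rw [← spectrum.singleton_sub_eq] at h
  obtain ⟨r, hr, μ, hμ, hi⟩ := Set.mem_sub.1 h
  rw [Set.mem_singleton_iff] at hr
  have hbdd : BddAbove (spectrum ℝ M) := by
    rw [hM.spectrum_real_eq_range_eigenvalues]
    exact (Set.finite_range _).bddAbove
  have : μ ≤ specRad M := le_csSup hbdd hμ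
  simp only [Pi.zero_apply]
  linarith

lemma dotProduct_mulVec_le_specRad {n : ℕ} {M : Matrix (Fin n) (Fin n) ℝ} (hM : M.IsHermitian)
    (x : Fin n → ℝ) : x ⬝ᵥ M.mulVec x ≤ specRad M * (x ⬝ᵥ x) := by
  have h := (posSemidef_specRad_sub hM).dotProduct_mulVec_nonneg x
  simp only [star_trivial, Matrix.sub_mulVec, Algebra.algebraMap_eq_smul_one, Matrix.smul_mulVec,
    Matrix.one_mulVec, dotProduct_sub, dotProduct_smul, smul_eq_mul] at h
  linarith

lemma mulVec_eq_of_specRad_le {n : ℕ} {M : Matrix (Fin n) (Fin n) ℝ} (hM : M.IsHermitian)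
    {x : Fin n → ℝ} (hx : specRad M * (x ⬝ᵥ x) ≤ x ⬝ᵥ M.mulVec x) :
    M.mulVec x = specRad M • x := by
  have h := (posSemidef_specRad_sub hM).dotProduct_mulVec_zero_iff x
  simp only [star_trivial, Matrix.sub_mulVec, Algebra.algebraMap_eq_smul_one, Matrix.smul_mulVec,
    Matrix.one_mulVec, dotProduct_sub, dotProduct_smul, smul_eq_mul] at h
  have h0 := h.1 (by linarith [dotProduct_mulVec_le_specRad hM x])
  exact (sub_eq_zero.1 h0).symm

lemma exists_eigenvector_specRad {n : ℕ} (hn : 0 < n) {M : Matrix (Fin n) (Fin n) ℝ}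
    (hM : M.IsHermitian) : ∃ y : Fin n → ℝ, y ≠ 0 ∧ M.mulVec y = specRad M • y := by
  have hmem : specRad M ∈ spectrum ℝ M := by
    have : Nonempty (Fin n) := ⟨⟨0, hn⟩⟩
    unfold specRad
    rw [hM.spectrum_real_eq_range_eigenvalues]
    exact (Set.range_nonempty _).csSup_mem (Set.finite_range _)
  rw [spectrum.mem_iff, Matrix.isUnit_iff_isUnit_det, isUnit_iff_ne_zero, not_not,
    ← Matrix.exists_mulVec_eq_zero_iff] at hmem
  obtain ⟨y, hy, h0⟩ := hmem
  refine ⟨y, hy, ?_⟩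
  simp only [Matrix.sub_mulVec, Algebra.algebraMap_eq_smul_one, Matrix.smul_mulVec,
    Matrix.one_mulVec] at h0
  exact (sub_eq_zero.1 h0).symm

/-- A symmetric entrywise nonnegative matrix has a nonnegative eigenvector, normalised to have
maximal entry `1`, for its largest eigenvalue. -/
lemma exists_nonneg_eigenvector {n : ℕ} (hn : 0 < n) {M : Matrix (Fin n) (Fin n) ℝ}
    (hM : M.IsHermitian) (hpos : ∀ i j, 0 ≤ M i j) :
    ∃ x : Fin n → ℝ, (∀ i, 0 ≤ x i) ∧ (∀ i, x i ≤ 1) ∧ (∃ u, x u = 1) ∧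
      M.mulVec x = specRad M • x := by
  obtain ⟨y, hy, hMy⟩ := exists_eigenvector_specRad hn hM
  have habs : M.mulVec (fun i => |y i|) = specRad M • fun i => |y i| := by
    apply mulVec_eq_of_specRad_le hM
    have h1 : (fun i => |y i|) ⬝ᵥ (fun i => |y i|) = y ⬝ᵥ y := by
      simp [dotProduct]
    have h2 : specRad M * (y ⬝ᵥ y) = y ⬝ᵥ M.mulVec y := by
      rw [hMy, dotProduct_smul, smul_eq_mul]
    rw [h1, h2]
    simp only [dotProduct, Matrix.mulVec, Finset.mul_sum]
    refine Finset.sum_le_sum fun i _ => Finset.sum_le_sum fun j _ => ?_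
    have h3 : y i * y j ≤ |y i| * |y j| := by
      rw [← abs_mul]
      exact le_abs_self _
    nlinarith [mul_le_mul_of_nonneg_left h3 (hpos i j)]
  obtain ⟨u, -, hu⟩ := Finset.exists_max_image Finset.univ (fun i => |y i|) ⟨⟨0, hn⟩, by simp⟩
  have hu0 : 0 < |y u| := by
    obtain ⟨i, hi⟩ := Function.ne_iff.1 hy
    exact (abs_pos.2 hi).trans_le (hu i (by simp))
  refine ⟨|y u|⁻¹ • fun i => |y i|, fun i => ?_, fun i => ?_, ⟨u, ?_⟩, ?_⟩
  · simp only [Pi.smul_apply, smul_eq_mul]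
    positivity
  · simp only [Pi.smul_apply, smul_eq_mul]
    rw [inv_mul_le_iff₀ hu0]
    simpa using hu i (by simp)
  · simp [hu0.ne']
  · rw [Matrix.mulVec_smul, habs, smul_comm]

lemma isHermitian_alphaMat (α : ℝ) {n : ℕ} (G : SimpleGraph (Fin n)) :
    (alphaMat α G).IsHermitian := by
  ext i j
  rcases eq_or_ne i j with rfl | hij
  · simp
  · simp [degMat, adjMat, Matrix.diagonal_apply_ne _ hij, Matrix.diagonal_apply_ne _ hij.symm,
      G.adj_comm]

lemma alphaMat_nonneg {α : ℝ} (hα0 : 0 ≤ α) (hα1 : α ≤ 1) {n : ℕ} (G : SimpleGraph (Fin n))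
    (i j : Fin n) : 0 ≤ alphaMat α G i j := by
  have h1 : 0 ≤ degMat G i j := by
    unfold degMat
    rw [Matrix.diagonal_apply]
    split_ifs <;> positivity
  have h2 : 0 ≤ adjMat G i j := by
    unfold adjMat
    rw [Matrix.of_apply]
    split_ifs <;> norm_num
  simp only [alphaMat, Matrix.add_apply, Matrix.smul_apply, smul_eq_mul]
  have := sub_nonneg.2 hα1
  positivity

lemma alphaMat_mulVec (α : ℝ) {n : ℕ} (G : SimpleGraph (Fin n)) (x : Fin n → ℝ) (i : Fin n) :
    (alphaMat α G).mulVec x i = ∑ j, if G.Adj i j then α * x i + (1 - α) * x j else 0 := by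
  simp only [alphaMat, Matrix.add_mulVec, Matrix.smul_mulVec, degMat, adjMat, Pi.add_apply,
    Pi.smul_apply, Matrix.mulVec_diagonal, smul_eq_mul]
  have hcard : (Nat.card {j // G.Adj i j} : ℝ) = ∑ j, if G.Adj i j then (1 : ℝ) else 0 := by
    rw [Nat.card_eq_fintype_card, Fintype.card_subtype, Finset.sum_boole]
  rw [hcard]
  simp only [Matrix.mulVec, dotProduct, Matrix.of_apply]
  rw [Finset.sum_mul, Finset.mul_sum, Finset.mul_sum, ← Finset.sum_add_distrib]
  refine Finset.sum_congr rfl fun j _ => ?_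
  split_ifs <;> simp

lemma sum_alphaMat_le (α : ℝ) {n : ℕ} (G : SimpleGraph (Fin n)) (x : Fin n → ℝ) :
    (∑ i, ∑ j, if G.Adj i j then α * x i ^ 2 + (1 - α) * (x i * x j) else 0) ≤
      rhoAlpha α G * ∑ i, x i ^ 2 := by
  have h := dotProduct_mulVec_le_specRad (isHermitian_alphaMat α G) x
  simp only [dotProduct, alphaMat_mulVec, Finset.mul_sum] at h
  rw [Finset.mul_sum]
  refine (Eq.trans_le ?_ h).trans_eq ?_
  · refine Finset.sum_congr rfl fun i _ => Finset.sum_congr rfl fun j _ => ?_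
    split_ifs <;> ring
  · refine Finset.sum_congr rfl fun i _ => ?_
    rw [rhoAlpha]
    ring

lemma exists_perron_vector {α : ℝ} (hα0 : 0 ≤ α) (hα1 : α ≤ 1) {n : ℕ} (hn : 0 < n)
    (G : SimpleGraph (Fin n)) :
    ∃ x : Fin n → ℝ, (∀ i, 0 ≤ x i) ∧ (∀ i, x i ≤ 1) ∧ (∃ u, x u = 1) ∧
      ∀ i, (∑ j, if G.Adj i j then α * x i + (1 - α) * x j else 0) = rhoAlpha α G * x i := by
  obtain ⟨x, h0, h1, hu, hx⟩ :=
    exists_nonneg_eigenvector hn (isHermitian_alphaMat α G) (alphaMat_nonneg hα0 hα1 G)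
  refine ⟨x, h0, h1, hu, fun i => ?_⟩
  rw [← alphaMat_mulVec, hx]
  rfl

/-- A positive eigenvector belongs to the largest eigenvalue. -/
lemma rhoAlpha_eq_of_pos_eigenvector {α : ℝ} (hα0 : 0 ≤ α) (hα1 : α ≤ 1) {n : ℕ} (hn : 0 < n)
    (G : SimpleGraph (Fin n)) {y : Fin n → ℝ} (hy : ∀ i, 0 < y i) {τ : ℝ}
    (h : ∀ i, (∑ j, if G.Adj i j then α * y i + (1 - α) * y j else 0) = τ * y i) :
    rhoAlpha α G = τ := by
  obtain ⟨x, hx0, -, ⟨u, hu⟩, hx⟩ :=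
    exists_nonneg_eigenvector hn (isHermitian_alphaMat α G) (alphaMat_nonneg hα0 hα1 G)
  have hMy : (alphaMat α G).mulVec y = τ • y := by
    ext i
    rw [alphaMat_mulVec, h]
    rfl
  have hsymm : y ⬝ᵥ (alphaMat α G).mulVec x = x ⬝ᵥ (alphaMat α G).mulVec y := by
    rw [Matrix.dotProduct_mulVec, ← Matrix.mulVec_transpose, dotProduct_comm]
    congr 2
    exact isHermitian_alphaMat α G
  rw [hx, hMy, dotProduct_smul, dotProduct_smul, smul_eq_mul, smul_eq_mul,
    dotProduct_comm y x] at hsymm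
  have hpos : 0 < x ⬝ᵥ y :=
    Finset.sum_pos' (fun i _ => mul_nonneg (hx0 i) (hy i).le)
      ⟨u, Finset.mem_univ u, by rw [hu]; simpa using hy u⟩
  exact mul_right_cancel₀ hpos.ne' hsymm

end AlphaSpectral

namespace LinearForest

/-- Positions of a linear forest that are sent to the small side of a complete bipartite graph:
the odd positions of every path, except that the path with index `i₀` starts with a free edge and
uses the even positions from `2` on. -/
def IsHub {ℓ : ℕ} {k : Fin ℓ → ℕ} (i₀ : Fin ℓ) (q : (i : Fin ℓ) × Fin (k i)) : Prop :=
  (q.1 = i₀ ∧ q.2.val % 2 = 0 ∧ 2 ≤ q.2.val) ∨ (q.1 ≠ i₀ ∧ q.2.val % 2 = 1)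

lemma card_isHub_le {ℓ : ℕ} (k : Fin ℓ → ℕ) (i₀ : Fin ℓ) (h2 : 2 ≤ k i₀) (heven : Even (k i₀)) :
    Fintype.card {q : (i : Fin ℓ) × Fin (k i) // IsHub i₀ q} + 1 ≤ ∑ i, k i / 2 := by
  have hfib : ∀ i, (Finset.univ.filter fun j : Fin (k i) =>
      IsHub i₀ (⟨i, j⟩ : (i : Fin ℓ) × Fin (k i))).card + (if i = i₀ then 1 else 0) ≤ k i / 2 := by
    intro i
    by_cases hi : i = i₀
    · subst hi
      obtain ⟨r, hr⟩ := heven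
      have : (Finset.univ.filter fun j : Fin (k i) =>
          IsHub i (⟨i, j⟩ : (i : Fin ℓ) × Fin (k i))).card ≤ (Finset.range (k i / 2 - 1)).card := by
        apply Finset.card_le_card_of_injOn (fun j => j.val / 2 - 1)
        · intro j hj
          simp only [IsHub, Finset.coe_filter, Set.mem_ofPred_eq] at hj
          simp only [Finset.coe_range, Set.mem_Iio]
          have := j.isLt
          grind
        · intro a ha b hb hab
          simp only [IsHub, Finset.coe_filter, Set.mem_ofPred_eq] at ha hb
          ext
          grind
      rw [Finset.card_range] at this
      simp only [if_true]
      omega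
    · have : (Finset.univ.filter fun j : Fin (k i) =>
          IsHub i₀ (⟨i, j⟩ : (i : Fin ℓ) × Fin (k i))).card ≤ (Finset.range (k i / 2)).card := by
        apply Finset.card_le_card_of_injOn (fun j => j.val / 2)
        · intro j hj
          simp only [IsHub] at hj
          simp only [Finset.coe_range, Set.mem_Iio]
          have := j.isLt
          grind
        · intro a ha b hb hab
          simp only [IsHub] at ha hb
          ext
          grind
      simpa [hi] using this
  have hsig : (Finset.univ.filter fun q : (i : Fin ℓ) × Fin (k i) => IsHub i₀ q) =
      Finset.univ.sigma fun i => Finset.univ.filter fun j : Fin (k i) =>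
        IsHub i₀ (⟨i, j⟩ : (i : Fin ℓ) × Fin (k i)) := by
    ext ⟨i, j⟩
    simp
  rw [Fintype.card_subtype, hsig, Finset.card_sigma]
  have := Finset.sum_le_sum fun i (_ : i ∈ Finset.univ) => hfib i
  rw [Finset.sum_add_distrib] at this
  simpa using this

/-- A complete bipartite graph between `p` vertices and many others, together with one further
edge leaving the large side, contains the linear forest. -/
lemma containsLinearForest_of_hubs {V : Type*} {G : SimpleGraph V} {ℓ : ℕ}
    {k : Fin ℓ → ℕ} {p : ℕ} (hp : p + 1 = ∑ i, k i / 2) {i₀ : Fin ℓ} (h2 : 2 ≤ k i₀)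
    (heven : Even (k i₀)) {B M : Finset V} (hB : B.card = p) (hM : ∑ i, k i + 2 ≤ M.card)
    (hBM : ∀ b ∈ B, ∀ m ∈ M, G.Adj b m) {v w : V} (hv : v ∈ M) (hw : w ∉ B) (hvw : G.Adj v w) :
    ContainsLinearForest G k := by
  have hdisj : ∀ b ∈ B, ∀ m ∈ M, b ≠ m := fun b hb m hm => (hBM b hb m hm).ne
  obtain ⟨e⟩ : Nonempty ({q : (i : Fin ℓ) × Fin (k i) // IsHub i₀ q} ↪ B) := by
    apply Function.Embedding.nonempty_of_card_le
    have := card_isHub_le k i₀ h2 heven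
    simp only [Fintype.card_coe]
    omega
  obtain ⟨g⟩ : Nonempty (((i : Fin ℓ) × Fin (k i)) ↪ ((M.erase v).erase w : Finset V)) := by
    apply Function.Embedding.nonempty_of_card_le
    have h1 := Finset.pred_card_le_card_erase (s := M) (a := v)
    have h3 := Finset.pred_card_le_card_erase (s := M.erase v) (a := w)
    simp only [Fintype.card_coe, Fintype.card_sigma, Fintype.card_fin]
    omega
  have he : ∀ q, (e q : V) ∈ B := fun q => (e q).2
  have hg : ∀ q, (g q : V) ≠ w ∧ (g q : V) ≠ v ∧ (g q : V) ∈ M := fun q =>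
    have h := Finset.mem_erase.1 (g q).2
    ⟨h.1, Finset.mem_erase.1 h.2⟩
  have hvB : v ∉ B := fun h => hdisj v h v hv rfl
  let F : ((i : Fin ℓ) × Fin (k i)) → V := fun q =>
    if h : IsHub i₀ q then e ⟨q, h⟩
    else if q.1 = i₀ ∧ q.2.val = 0 then w
    else if q.1 = i₀ ∧ q.2.val = 1 then v
    else g q
  have hFhub : ∀ q, ∀ h : IsHub i₀ q, F q = e ⟨q, h⟩ := fun q h => by simp only [F, dif_pos h]
  have hFw : ∀ q : (i : Fin ℓ) × Fin (k i), q.1 = i₀ → q.2.val = 0 → F q = w := by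
    intro q h h'
    have : ¬ IsHub i₀ q := by
      unfold IsHub
      omega
    simp only [F, dif_neg this, h, h', and_self, if_true]
  have hFv : ∀ q : (i : Fin ℓ) × Fin (k i), q.1 = i₀ → q.2.val = 1 → F q = v := by
    intro q h h'
    have : ¬ IsHub i₀ q := by
      unfold IsHub
      omega
    simp only [F, dif_neg this, h, h', and_self, if_true, one_ne_zero, and_false, if_false]
  have hFM : ∀ q, ¬ IsHub i₀ q → ¬ (q.1 = i₀ ∧ q.2.val = 0) → F q ∈ M := by
    intro q h h'
    simp only [F, dif_neg h, if_neg h']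
    split_ifs
    · exact hv
    · exact (hg q).2.2
  have hinj : Function.Injective F := by
    have hend : ∀ c : ℕ, ∀ a b : (i : Fin ℓ) × Fin (k i), a.1 = i₀ ∧ a.2.val = c →
        b.1 = i₀ ∧ b.2.val = c → a = b := by
      rintro c ⟨i, a⟩ ⟨j, b⟩ ⟨rfl, ha⟩ ⟨rfl, hb⟩
      have : a = b := Fin.ext (ha.trans hb.symm)
      rw [this]
    intro a b hab
    simp only [F] at hab
    have hne : v ≠ w := hvw.ne
    split_ifs at hab
    all_goals first
      | (have := e.injective (Subtype.ext hab); simpa using this)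
      | exact g.injective (Subtype.ext hab)
      | exact hend _ a b (by assumption) (by assumption)
      | (exfalso; revert hab; grind)
  have hadj : ∀ (i : Fin ℓ) (a b : Fin (k i)), a.val + 1 = b.val → G.Adj (F ⟨i, a⟩) (F ⟨i, b⟩) := by
    intro i a b hab
    by_cases ha : IsHub i₀ (⟨i, a⟩ : (i : Fin ℓ) × Fin (k i))
    · rw [hFhub _ ha]
      have hb : ¬ IsHub i₀ (⟨i, b⟩ : (i : Fin ℓ) × Fin (k i)) := by
        simp only [IsHub] at ha ⊢
        omega
      exact hBM _ (he _) _ (hFM _ hb (by simp only; omega))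
    · by_cases hb : IsHub i₀ (⟨i, b⟩ : (i : Fin ℓ) × Fin (k i))
      · rw [hFhub _ hb]
        refine (hBM _ (he _) _ (hFM _ ha ?_)).symm
        simp only [IsHub] at hb ⊢
        omega
      · have h0 : i = i₀ ∧ a.val = 0 := by
          simp only [IsHub] at ha hb
          omega
        rw [hFw _ h0.1 h0.2, hFv _ h0.1 (by simp only; omega)]
        exact hvw.symm
  refine ⟨fun i a => F ⟨i, a⟩, hinj, fun i a b hab => ?_⟩
  rw [SimpleGraph.pathGraph_adj] at hab
  rcases hab with hab | hab
  · exact hadj i a b hab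
  · exact (hadj i b a hab).symm

/-- The common neighbours of a set of vertices. -/
noncomputable def commonNbrs {n : ℕ} (G : SimpleGraph (Fin n)) (B : Finset (Fin n)) :
    Finset (Fin n) :=
  Finset.univ.filter fun v => ∀ b ∈ B, G.Adj b v

lemma not_adj_of_free {n : ℕ} {G : SimpleGraph (Fin n)} {ℓ : ℕ} {k : Fin ℓ → ℕ}
    (hk : ∀ i, 2 ≤ k i) {p : ℕ} (hp : p + 1 = ∑ i, k i / 2) (heven : ∃ i, Even (k i))
    (hG : ¬ ContainsLinearForest G k) {B : Finset (Fin n)} (hB : B.card = p)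
    (hM : ∑ i, k i + 2 ≤ (commonNbrs G B).card) {v w : Fin n} (hv : v ∈ commonNbrs G B)
    (hw : w ∉ B) : ¬ G.Adj v w := by
  obtain ⟨i₀, hi₀⟩ := heven
  refine fun hvw => hG (containsLinearForest_of_hubs hp (hk i₀) hi₀ hB hM ?_ hv hw hvw)
  intro b hb m hm
  exact (Finset.mem_filter.1 hm).2 b hb

lemma card_commonNbrs_lt_of_free {n : ℕ} {G : SimpleGraph (Fin n)} {ℓ : ℕ} {k : Fin ℓ → ℕ}
    (hk : ∀ i, 2 ≤ k i) {p : ℕ} (hp : p + 1 = ∑ i, k i / 2) (heven : ∃ i, Even (k i))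
    (hG : ¬ ContainsLinearForest G k) {B : Finset (Fin n)} (hB : B.card = p + 1) :
    (commonNbrs G B).card < ∑ i, k i + 2 := by
  by_contra! hM
  obtain ⟨b, hb⟩ : B.Nonempty := Finset.card_pos.1 (by omega)
  obtain ⟨v, hv⟩ : (commonNbrs G B).Nonempty := Finset.card_pos.1 (by omega)
  have hsub : commonNbrs G B ⊆ commonNbrs G (B.erase b) := by
    intro v hv
    simp only [commonNbrs, Finset.mem_filter, Finset.mem_univ, true_and] at hv ⊢
    exact fun c hc => hv c (Finset.mem_of_mem_erase hc)
  refine not_adj_of_free hk hp heven hG (B := B.erase b) ?_ (hM.trans (Finset.card_le_card hsub))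
    (hsub hv) (Finset.notMem_erase b B) ((Finset.mem_filter.1 hv).2 b hb).symm
  rw [Finset.card_erase_of_mem hb, hB]
  rfl

/-- The degree of a vertex as a real number. -/
noncomputable def rdeg {n : ℕ} (G : SimpleGraph (Fin n)) (i : Fin n) : ℝ :=
  ∑ j, if G.Adj i j then (1 : ℝ) else 0

lemma rdeg_le {n : ℕ} (G : SimpleGraph (Fin n)) (i : Fin n) : rdeg G i ≤ n - 1 := by
  have h : rdeg G i ≤ ∑ j, (1 - if j = i then (1 : ℝ) else 0) := by
    refine Finset.sum_le_sum fun j _ => ?_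
    split_ifs with h1 h2 h2
    · exact absurd h2.symm h1.ne
    all_goals norm_num
  simpa using h

lemma le_card_commonNbrs {n : ℕ} (G : SimpleGraph (Fin n)) (B : Finset (Fin n)) :
    (n : ℝ) - ∑ b ∈ B, ((n : ℝ) - rdeg G b) ≤ (commonNbrs G B).card := by
  have h1 : ∀ b, (n : ℝ) - rdeg G b = ∑ v, (1 - if G.Adj b v then (1 : ℝ) else 0) := by
    intro b
    simp [rdeg]
  have h2 : (n : ℝ) - ∑ b ∈ B, ((n : ℝ) - rdeg G b) =
      ∑ v, ((1 : ℝ) - ∑ b ∈ B, (1 - if G.Adj b v then (1 : ℝ) else 0)) := by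
    rw [Finset.sum_congr rfl fun b _ => h1 b, Finset.sum_comm]
    conv_rhs => rw [Finset.sum_sub_distrib]
    congr 1
    simp
  rw [h2, commonNbrs, Finset.card_filter, Nat.cast_sum]
  refine Finset.sum_le_sum fun v _ => ?_
  have hnonneg : ∀ b ∈ B, 0 ≤ 1 - if G.Adj b v then (1 : ℝ) else 0 := by
    intro b _
    split_ifs <;> norm_num
  by_cases hv : ∀ b ∈ B, G.Adj b v
  · rw [if_pos hv]
    simpa using Finset.sum_nonneg hnonneg
  · rw [if_neg hv]
    push Not at hv
    obtain ⟨b, hb, hbv⟩ := hv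
    have := Finset.single_le_sum hnonneg hb
    simp only [hbv, if_false, sub_zero] at this
    simpa using this

/-- If no `p + 1` vertices have `m` common neighbours, then only boundedly many vertices have
degree at least `ε n`. -/
lemma card_rdeg_ge_lt {n p m t : ℕ} {ε : ℝ} {G : SimpleGraph (Fin n)}
    (hG : ∀ B : Finset (Fin n), B.card = p + 1 → (commonNbrs G B).card < m)
    (ht : (p : ℝ) + 1 ≤ ε * t) (hn : t * (t.choose (p + 1) * m) < n) :
    (Finset.univ.filter fun v => ε * n ≤ rdeg G v).card < t := by
  by_contra! hL
  obtain ⟨T, hTL, hT⟩ := Finset.exists_subset_card_eq hL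
  have hlow : ((p : ℝ) + 1) * n ≤ ∑ w ∈ T, rdeg G w := by
    calc ((p : ℝ) + 1) * n ≤ ε * t * n := by gcongr
      _ = ∑ w ∈ T, ε * n := by
        rw [Finset.sum_const, hT, nsmul_eq_mul]
        ring
      _ ≤ ∑ w ∈ T, rdeg G w :=
        Finset.sum_le_sum fun w hw => (Finset.mem_filter.1 (hTL hw)).2
  have hswap : ∑ w ∈ T, rdeg G w = ((∑ v, (T.filter fun w => G.Adj w v).card : ℕ) : ℝ) := by
    simp only [rdeg]
    rw [Finset.sum_comm]
    simp
  have hc : ∀ v, (T.filter fun w => G.Adj w v).card ≤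
      p + t * ∑ S ∈ T.powersetCard (p + 1), if v ∈ commonNbrs G S then 1 else 0 := by
    intro v
    by_cases hv : (T.filter fun w => G.Adj w v).card ≤ p
    · omega
    · obtain ⟨S, hS, hScard⟩ := Finset.exists_subset_card_eq (not_le.1 hv)
      have hSmem : S ∈ T.powersetCard (p + 1) :=
        Finset.mem_powersetCard.2 ⟨hS.trans (Finset.filter_subset _ _), hScard⟩
      have hvS : v ∈ commonNbrs G S :=
        Finset.mem_filter.2 ⟨Finset.mem_univ _, fun b hb => (Finset.mem_filter.1 (hS hb)).2⟩
      have h1 : 1 ≤ ∑ S ∈ T.powersetCard (p + 1), if v ∈ commonNbrs G S then 1 else 0 := by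
        have := Finset.single_le_sum (f := fun S => if v ∈ commonNbrs G S then 1 else 0)
          (fun _ _ => Nat.zero_le _) hSmem
        simpa [hvS] using this
      have h2 : (T.filter fun w => G.Adj w v).card ≤ t := hT ▸ Finset.card_filter_le _ _
      nlinarith
  have hsum : ∑ v, (T.filter fun w => G.Adj w v).card ≤ n * p + t * (t.choose (p + 1) * m) := by
    calc ∑ v, (T.filter fun w => G.Adj w v).card
        ≤ ∑ v, (p + t * ∑ S ∈ T.powersetCard (p + 1), if v ∈ commonNbrs G S then 1 else 0) :=
          Finset.sum_le_sum fun v _ => hc v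
      _ = n * p + t * ∑ S ∈ T.powersetCard (p + 1), (commonNbrs G S).card := by
        rw [Finset.sum_add_distrib, ← Finset.mul_sum, Finset.sum_comm]
        simp
      _ ≤ n * p + t * ∑ S ∈ T.powersetCard (p + 1), m := by
        gcongr with S hS
        exact (hG S (Finset.mem_powersetCard.1 hS).2).le
      _ = n * p + t * (t.choose (p + 1) * m) := by
        rw [Finset.sum_const, Finset.card_powersetCard, hT, smul_eq_mul]
  rw [hswap] at hlow
  have hlow' : (p + 1) * n ≤ ∑ v, (T.filter fun w => G.Adj w v).card := by exact_mod_cast hlow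
  nlinarith

end LinearForest

namespace CompleteSplit

/-- The complete split graph in which the vertices of `B` dominate and the others are
independent. -/
def splitGraph {n : ℕ} (B : Finset (Fin n)) : SimpleGraph (Fin n) :=
  SimpleGraph.fromRel fun i j => i ∈ B ∨ j ∈ B

lemma splitGraph_adj {n : ℕ} (B : Finset (Fin n)) (i j : Fin n) :
    (splitGraph B).Adj i j ↔ i ≠ j ∧ (i ∈ B ∨ j ∈ B) := by
  simp only [splitGraph, SimpleGraph.fromRel_adj]
  tauto

lemma Snp_adj (n p : ℕ) (i j : Fin n) :
    (Snp n p).Adj i j ↔ i ≠ j ∧ (i.val < p ∨ j.val < p) := by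
  simp only [Snp, SimpleGraph.fromRel_adj]
  tauto

lemma card_val_lt {n p : ℕ} (hpn : p ≤ n) :
    (Finset.univ.filter fun i : Fin n => i.val < p).card = p := by
  simp [Fin.card_filter_val_lt, hpn]

lemma nonempty_iso_Snp_iff {n p : ℕ} (hpn : p ≤ n) (G : SimpleGraph (Fin n)) :
    Nonempty (G ≃g Snp n p) ↔ ∃ B : Finset (Fin n), B.card = p ∧ G = splitGraph B := by
  constructor
  · rintro ⟨e⟩
    refine ⟨Finset.univ.filter fun i => (e i).val < p, ?_, ?_⟩
    · exact (Finset.card_equiv e.toEquiv (by simp)).trans (card_val_lt hpn)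
    · ext i j
      rw [← e.map_adj_iff, Snp_adj, splitGraph_adj]
      simp
  · rintro ⟨B, hB, rfl⟩
    have hcard : Fintype.card {i // i ∈ B} = Fintype.card {i : Fin n // i.val < p} := by
      rw [Fintype.card_coe, hB, Fintype.card_subtype, card_val_lt hpn]
    let e := (Fintype.equivOfCardEq hcard).extendSubtype
    have he : ∀ i, (e i).val < p ↔ i ∈ B := fun i =>
      ⟨fun h => by_contra fun hi => Equiv.extendSubtype_not_mem (Fintype.equivOfCardEq hcard) i hi h,
        fun h => Equiv.extendSubtype_mem (Fintype.equivOfCardEq hcard) i h⟩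
    refine ⟨⟨e, fun {i j} => ?_⟩⟩
    rw [Snp_adj, splitGraph_adj, he, he, e.injective.ne_iff]

/-- The closed form of the `A_α`-spectral radius of the complete split graph. -/
noncomputable def splitRadius (α : ℝ) (n p : ℕ) : ℝ :=
  (α * (n : ℝ) + (p : ℝ) - 1 +
    Real.sqrt ((α * (n : ℝ) + (p : ℝ) - 1) ^ 2 - 4 * (p : ℝ) * (2 * α - 1) * (n : ℝ) -
      4 * (p : ℝ) * ((p : ℝ) - ((p : ℝ) + 1) * α))) / 2

/-- The characteristic polynomial of the quotient matrix of the complete split graph. -/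
noncomputable def quotientPoly (α : ℝ) (n p : ℕ) (z : ℝ) : ℝ :=
  (z - (α * (n - 1) + (1 - α) * (p - 1))) * (z - α * p) - (1 - α) ^ 2 * p * (n - p)

lemma le_splitRadius {α z : ℝ} {n p : ℕ} (h : quotientPoly α n p z ≤ 0) :
    z ≤ splitRadius α n p ∧ quotientPoly α n p (splitRadius α n p) = 0 := by
  have hD : (2 * z - (α * n + p - 1)) ^ 2 ≤ (α * (n : ℝ) + (p : ℝ) - 1) ^ 2 -
      4 * (p : ℝ) * (2 * α - 1) * (n : ℝ) - 4 * (p : ℝ) * ((p : ℝ) - ((p : ℝ) + 1) * α) := by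
    unfold quotientPoly at h
    linarith
  unfold splitRadius quotientPoly
  have h1 := Real.le_sqrt_of_sq_le hD
  have h2 := Real.sq_sqrt ((sq_nonneg _).trans hD)
  constructor
  · linarith
  · linear_combination h2 / 4

lemma eventually_le_splitRadius {α : ℝ} (hα0 : 0 < α) (p : ℕ) {δ : ℝ} (hδ : 0 < δ) :
    ∀ᶠ n : ℕ in Filter.atTop,
      α * (n - 1) + (1 - α) * (p - 1) + (1 - α) ^ 2 * p / α - δ ≤ splitRadius α n p ∧
      quotientPoly α n p (splitRadius α n p) = 0 := by
  have h : Filter.Tendsto (fun n : ℕ => δ * α * (n : ℝ)) Filter.atTop Filter.atTop :=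
    tendsto_natCast_atTop_atTop.const_mul_atTop (by positivity)
  set c := (1 - α) ^ 2 * p / α with hc
  have hcα : (1 - α) ^ 2 * p = c * α := by
    rw [hc]
    field_simp
  filter_upwards [h.eventually_ge_atTop
    ((c - δ) * (-α + (1 - α) * (p - 1) + c - δ - α * p) + c * α * p)] with n hn
  apply le_splitRadius
  unfold quotientPoly
  rw [hcα]
  linarith

lemma rhoAlpha_splitGraph {α : ℝ} (hα0 : 0 < α) (hα1 : α < 1) {n p : ℕ} (hp : 0 < p)
    {B : Finset (Fin n)} (hB : B.card = p) {τ : ℝ} (hτ : quotientPoly α n p τ = 0)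
    (hτp : α * p < τ) : rhoAlpha α (splitGraph B) = τ := by
  have hn : 0 < n := by
    have := Finset.card_le_univ B
    rw [Fintype.card_fin] at this
    omega
  have hp' : (0 : ℝ) < p := by exact_mod_cast hp
  have h1α : 0 < 1 - α := sub_pos.2 hα1
  set s : ℝ := (τ - α * p) / ((1 - α) * p) with hs
  have hs0 : 0 < s := div_pos (sub_pos.2 hτp) (by positivity)
  have hs1 : (1 - α) * p * s = τ - α * p := by
    rw [hs]
    field_simp
  have hs2 : (τ - (α * (n - 1) + (1 - α) * (p - 1))) * s = (1 - α) * (n - p) := by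
    have hne : (1 - α) * (p : ℝ) ≠ 0 := by positivity
    apply mul_left_cancel₀ hne
    unfold quotientPoly at hτ
    linear_combination hτ + (τ - (α * (n - 1) + (1 - α) * (p - 1))) * hs1
  have hsum : ∑ j, (if j ∈ B then s else 1) = p * s + (n - p) := by
    have : ∀ j, (if j ∈ B then s else 1) = (1 : ℝ) + if j ∈ B then s - 1 else 0 := by
      intro j
      split_ifs <;> ring
    simp only [this, Finset.sum_add_distrib, Finset.sum_ite_mem, Finset.univ_inter,
      Finset.sum_const, hB, Finset.card_univ, Fintype.card_fin, nsmul_eq_mul]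
    ring
  refine AlphaSpectral.rhoAlpha_eq_of_pos_eigenvector hα0.le hα1.le hn _
    (y := fun j => if j ∈ B then s else 1) (fun j => ?_) fun i => ?_
  · split_ifs
    · exact hs0
    · exact one_pos
  · simp only [splitGraph_adj]
    by_cases hi : i ∈ B
    · simp only [hi, true_or, and_true, if_true]
      have : ∀ j, (if i ≠ j then α * s + (1 - α) * (if j ∈ B then s else 1) else 0) =
          α * s + (1 - α) * (if j ∈ B then s else 1) - if i = j then s else 0 := by
        intro j
        rcases eq_or_ne i j with rfl | hij
        · simp only [ne_eq, not_true_eq_false, if_false, hi, if_true]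
          ring
        · simp [hij]
      simp only [this]
      rw [Finset.sum_sub_distrib, Finset.sum_add_distrib,
        ← Finset.mul_sum (f := fun j => if j ∈ B then s else 1), hsum]
      simp only [Finset.sum_const, Finset.card_univ, Fintype.card_fin, nsmul_eq_mul,
        Finset.sum_ite_eq, Finset.mem_univ, if_true]
      linear_combination -hs2
    · have : ∀ j, (if i ≠ j ∧ (i ∈ B ∨ j ∈ B) then
          α * (if i ∈ B then s else 1) + (1 - α) * (if j ∈ B then s else 1) else 0) =
          if j ∈ B then α + (1 - α) * s else 0 := by
        intro j
        by_cases hj : j ∈ B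
        · have : i ≠ j := fun h => hi (h ▸ hj)
          simp [hi, hj, this]
        · simp [hi, hj]
      rw [Finset.sum_congr rfl fun j _ => this j]
      simp only [Finset.sum_ite_mem, Finset.univ_inter, Finset.sum_const, hB, nsmul_eq_mul,
        hi, if_false]
      linear_combination hs1

end CompleteSplit

namespace PerronStructure

open LinearForest CompleteSplit

lemma mul_eq_neighbor_sum {α ρ : ℝ} {n : ℕ} {G : SimpleGraph (Fin n)} {x : Fin n → ℝ}
    (hx : ∀ i, (∑ j, if G.Adj i j then α * x i + (1 - α) * x j else 0) = ρ * x i) (i : Fin n) :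
    (ρ - α * rdeg G i) * x i = (1 - α) * ∑ j, if G.Adj i j then x j else 0 := by
  have h : (∑ j, if G.Adj i j then α * x i + (1 - α) * x j else 0) =
      α * x i * rdeg G i + (1 - α) * ∑ j, if G.Adj i j then x j else 0 := by
    rw [rdeg, Finset.mul_sum, Finset.mul_sum, ← Finset.sum_add_distrib]
    refine Finset.sum_congr rfl fun j _ => ?_
    split_ifs <;> ring
  linear_combination h - hx i

lemma neighbor_sum_le {n : ℕ} {G : SimpleGraph (Fin n)} {x : Fin n → ℝ} (h0 : ∀ i, 0 ≤ x i)
    (i : Fin n) : (∑ j, if G.Adj i j then x j else 0) ≤ ∑ j, x j - x i := by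
  have h : (∑ j, if G.Adj i j then x j else 0) ≤ ∑ j, (x j - if j = i then x j else 0) := by
    refine Finset.sum_le_sum fun j _ => ?_
    split_ifs with h1 h2 h2
    · exact absurd h2.symm h1.ne
    · simp
    · simp
    · simpa using h0 j
  simpa using h

/-- The entries at vertices of degree below `d` are controlled by the remaining entries. -/
lemma low_degree_sum_le {α ρ d : ℝ} (hα0 : 0 ≤ α) (hα1 : α ≤ 1) {n : ℕ} {G : SimpleGraph (Fin n)}
    {x : Fin n → ℝ} (h0 : ∀ i, 0 ≤ x i)
    (hx : ∀ i, (∑ j, if G.Adj i j then α * x i + (1 - α) * x j else 0) = ρ * x i) :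
    (ρ - d) * ∑ v ∈ Finset.univ.filter (fun v => ¬ d ≤ rdeg G v), x v ≤
      (1 - α) * n * ∑ v ∈ Finset.univ.filter (fun v => d ≤ rdeg G v), x v := by
  set L := Finset.univ.filter fun v => d ≤ rdeg G v
  set S := Finset.univ.filter fun v => ¬ d ≤ rdeg G v
  have hS : ∀ v ∈ S, rdeg G v ≤ d := fun v hv => (not_le.1 (Finset.mem_filter.1 hv).2).le
  have h1 : (ρ - α * d) * ∑ v ∈ S, x v ≤ ∑ v ∈ S, (ρ - α * rdeg G v) * x v := by
    rw [Finset.mul_sum]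
    refine Finset.sum_le_sum fun v hv => mul_le_mul_of_nonneg_right ?_ (h0 v)
    have := mul_le_mul_of_nonneg_left (hS v hv) hα0
    linarith
  have h2 : ∑ v ∈ S, (ρ - α * rdeg G v) * x v =
      (1 - α) * ∑ v ∈ S, ∑ w, if G.Adj v w then x w else 0 := by
    rw [Finset.mul_sum]
    exact Finset.sum_congr rfl fun v _ => mul_eq_neighbor_sum hx v
  have h3 : ∑ v ∈ S, (∑ w, if G.Adj v w then x w else 0) ≤ ∑ w, rdeg G w * x w := by
    calc ∑ v ∈ S, (∑ w, if G.Adj v w then x w else 0)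
        ≤ ∑ v, ∑ w, if G.Adj v w then x w else 0 := by
          refine Finset.sum_le_sum_of_subset_of_nonneg (Finset.subset_univ _) fun v _ _ => ?_
          refine Finset.sum_nonneg fun w _ => ?_
          split_ifs
          exacts [h0 w, le_rfl]
      _ = ∑ w, rdeg G w * x w := by
        rw [Finset.sum_comm]
        refine Finset.sum_congr rfl fun w _ => ?_
        rw [rdeg, Finset.sum_mul]
        refine Finset.sum_congr rfl fun v _ => ?_
        rw [G.adj_comm]
        split_ifs <;> ring
  have h4 : ∑ w, rdeg G w * x w ≤ n * ∑ v ∈ L, x v + d * ∑ v ∈ S, x v := by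
    rw [← Finset.sum_filter_add_sum_filter_not Finset.univ fun v => d ≤ rdeg G v,
      Finset.mul_sum, Finset.mul_sum]
    refine add_le_add (Finset.sum_le_sum fun v _ => ?_) (Finset.sum_le_sum fun v hv => ?_)
    · exact mul_le_mul_of_nonneg_right (by linarith [rdeg_le G v]) (h0 v)
    · exact mul_le_mul_of_nonneg_right (hS v hv) (h0 v)
  have h5 := mul_le_mul_of_nonneg_left (h3.trans h4) (sub_nonneg.2 hα1)
  rw [h2] at h1
  linarith

/-- In a graph without `p + 1` vertices having many common neighbours and with large
`A_α`-spectral radius, exactly `p` vertices carry almost all the weight of the Perron vector; they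
are adjacent to all but a bounded number of vertices. -/
lemma exists_hubs {α : ℝ} (hα0 : 0 < α) (hα1 : α < 1) {p : ℕ} (hp : 1 ≤ p) (m : ℕ) :
    ∃ C : ℝ, 0 < C ∧ ∀ᶠ n : ℕ in Filter.atTop, ∀ G : SimpleGraph (Fin n),
      (∀ B : Finset (Fin n), B.card = p + 1 → (commonNbrs G B).card < m) →
      ∀ (ρ : ℝ) (x : Fin n → ℝ), (∀ i, 0 ≤ x i) → (∀ i, x i ≤ 1) → (∃ u, x u = 1) →
      (∀ i, (∑ j, if G.Adj i j then α * x i + (1 - α) * x j else 0) = ρ * x i) →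
      α * (n - 1) + (1 - α) * (p - 1) + (1 - α) ^ 2 * p / α - (1 - α) / (8 * α) ≤ ρ →
      ∃ B : Finset (Fin n), B.card = p ∧ (∀ b ∈ B, 1 / 2 ≤ x b ∧ (n : ℝ) - rdeg G b ≤ C) ∧
        ∀ w ∉ B, n * x w ≤ C := by
  have hp' : (1 : ℝ) ≤ p := by exact_mod_cast hp
  have hp0 : (0 : ℝ) < p := by linarith
  set ε : ℝ := α / (32 * p) with hε
  have hε0 : 0 < ε := by positivity
  have hεp : 32 * p * ε = α := by
    rw [hε]
    field_simp
  obtain ⟨t, ht⟩ := exists_nat_ge (((p : ℝ) + 1) / ε)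
  have ht' : (p : ℝ) + 1 ≤ ε * t := by
    rw [div_le_iff₀ hε0] at ht
    linarith
  set K : ℝ := 2 * t / α with hK
  have hKα : K * α = 2 * t := by
    rw [hK]
    field_simp
  set η : ℝ := 1 / (2 * (p + 1)) with hη
  have hη0 : 0 < η := by positivity
  have hηp : η * (2 * (p + 1)) = 1 := by
    rw [hη]
    field_simp
  set K₁ : ℝ := 2 * K / (α * η) with hK₁
  have hK₁' : K₁ * (α * η) = 2 * K := by
    rw [hK₁]
    field_simp
  have hK0 : 0 ≤ K := by positivity
  have hK₁0 : 0 ≤ K₁ := by positivity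
  have hlarge : ∀ a b : ℝ, 0 < a → ∀ᶠ n : ℕ in Filter.atTop, b ≤ a * (n : ℝ) := fun a b ha =>
    (tendsto_natCast_atTop_atTop.const_mul_atTop ha).eventually_ge_atTop b
  refine ⟨(2 * K + 2) / α + K₁, by positivity, ?_⟩
  filter_upwards [Filter.eventually_gt_atTop (t * (t.choose (p + 1) * m)),
    hlarge ε 2 hε0, hlarge (α * η) 4 (by positivity), hlarge 1 (16 * (t * K₁)) one_pos,
    hlarge (1 / 2) m (by norm_num)] with n hn₁ hn₂ hn₃ hn₄ hn₅ G hG ρ x h0 h1 hu hx hρ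
  obtain ⟨u, hu⟩ := hu
  have hn0 : (0 : ℝ) < n := by
    by_contra! h
    linarith [mul_nonneg hε0.le (neg_nonneg.2 h)]
  have hcard := card_rdeg_ge_lt hG ht' hn₁
  have hlow := low_degree_sum_le (d := ε * n) hα0.le hα1.le h0 hx
  have htot := Finset.sum_filter_add_sum_filter_not Finset.univ (fun v => ε * n ≤ rdeg G v) x
  set L := Finset.univ.filter fun v => ε * n ≤ rdeg G v with hLdef
  set X := ∑ v ∈ L, x v with hX
  set Y := ∑ v ∈ Finset.univ.filter (fun v => ¬ ε * n ≤ rdeg G v), x v with hY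
  have hX0 : 0 ≤ X := Finset.sum_nonneg fun v _ => h0 v
  have hY0 : 0 ≤ Y := Finset.sum_nonneg fun v _ => h0 v
  have hXt : X ≤ t := by
    calc X ≤ ∑ v ∈ L, (1 : ℝ) := Finset.sum_le_sum fun v _ => h1 v
      _ = L.card := by simp
      _ ≤ t := by exact_mod_cast hcard.le
  have h1α : 0 < 1 - α := sub_pos.2 hα1
  have hρ' : α * (n - 1) + (1 - α) * ((p - 1 / 8) / α - 1) ≤ ρ := by
    refine le_trans (le_of_eq ?_) hρ
    field_simp
    ring
  have hρn : α * n - 2 ≤ ρ := by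
    have : 0 ≤ (p - 1 / 8) / α := div_nonneg (by linarith) hα0.le
    linarith [mul_nonneg h1α.le this]
  have hYX : (α - 2 * ε) * Y ≤ (1 - α) * X := by
    have h : (α - 2 * ε) * n * Y ≤ (1 - α) * n * X :=
      le_trans (mul_le_mul_of_nonneg_right (by linarith) hY0) hlow
    have h' : ((α - 2 * ε) * Y) * n ≤ ((1 - α) * X) * n := by linarith
    exact le_of_mul_le_mul_right h' hn0
  have hεα : 32 * ε ≤ α := by linarith [mul_le_mul_of_nonneg_left hp' hε0.le]
  have hSX : (α - 2 * ε) * (X + Y) ≤ X := by linarith [mul_nonneg hε0.le hX0]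
  have hSK : X + Y ≤ K := by
    have h : (X + Y) * α ≤ K * α := by
      rw [hKα]
      linarith [mul_le_mul_of_nonneg_right hεα (add_nonneg hX0 hY0)]
    exact le_of_mul_le_mul_right h hα0
  have hnbr : ∀ i, (ρ - α * rdeg G i) * x i ≤ K := by
    intro i
    rw [mul_eq_neighbor_sum hx i]
    have h2 := neighbor_sum_le (G := G) h0 i
    have h3 : 0 ≤ ∑ j, if G.Adj i j then x j else 0 := by
      refine Finset.sum_nonneg fun j _ => ?_
      split_ifs
      exacts [h0 j, le_rfl]
    have h4 := h0 i
    linarith [mul_nonneg hα0.le h3]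
  have hSp : p - 1 / 8 ≤ α * (X + Y) := by
    have h2 := mul_eq_neighbor_sum hx u
    have h3 := neighbor_sum_le (G := G) h0 u
    have h4 := rdeg_le G u
    rw [hu] at h2 h3
    rw [← htot] at h3
    have h5 : (1 - α) * ((p - 1 / 8) / α) ≤ (1 - α) * (X + Y) := by
      linarith [mul_le_mul_of_nonneg_left h3 h1α.le, mul_le_mul_of_nonneg_left h4 hα0.le]
    have h6 := le_of_mul_le_mul_left h5 h1α
    rw [div_le_iff₀ hα0] at h6
    linarith
  have hXp : p - 3 / 16 ≤ X := by
    refine le_trans ?_ hSX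
    have : (α - 2 * ε) * (X + Y) * (16 * p) = α * (X + Y) * (16 * p - 1) := by
      linear_combination (-(X + Y)) * hεp
    have h2 : (p - 3 / 16) * (16 * p) ≤ (α - 2 * ε) * (X + Y) * (16 * p) := by
      rw [this]
      have h3 : 0 ≤ 16 * (p : ℝ) - 1 := by linarith
      linarith [mul_le_mul_of_nonneg_right hSp h3]
    exact le_of_mul_le_mul_right h2 (by positivity)
  set B := Finset.univ.filter fun v => (1 - η) * n ≤ rdeg G v with hBdef
  have hout : ∀ w ∉ B, n * x w ≤ K₁ := by
    intro w hw
    have hd : rdeg G w < (1 - η) * n := by simpa [hBdef] using hw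
    have h2 : α * η * n / 2 ≤ ρ - α * rdeg G w := by
      linarith [mul_le_mul_of_nonneg_left hd.le hα0.le]
    have h3 := (mul_le_mul_of_nonneg_right h2 (h0 w)).trans (hnbr w)
    have h4 : (n * x w) * (α * η) ≤ K₁ * (α * η) := by
      rw [hK₁']
      linarith
    exact le_of_mul_le_mul_right h4 (by positivity)
  have hBp : B.card ≤ p := by
    by_contra! h
    obtain ⟨T, hTB, hT⟩ := Finset.exists_subset_card_eq (Nat.succ_le_of_lt h)
    have h2 := le_card_commonNbrs G T
    have h3 : ∑ b ∈ T, ((n : ℝ) - rdeg G b) ≤ ∑ b ∈ T, η * n := by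
      refine Finset.sum_le_sum fun b hb => ?_
      have := (Finset.mem_filter.1 (hTB hb)).2
      linarith
    rw [Finset.sum_const, hT, nsmul_eq_mul] at h3
    have h4 : ((commonNbrs G T).card : ℝ) < m := by exact_mod_cast hG T hT
    push_cast at h3
    have h5 : ((p : ℝ) + 1) * (η * n) = n / 2 := by linear_combination (n / 2 : ℝ) * hηp
    linarith
  have hXB : X ≤ ∑ v ∈ B, x v + 1 / 16 := by
    have h2 : X ≤ ∑ v ∈ B, x v + ∑ v ∈ L \ B, x v := by
      rw [← Finset.sum_union Finset.disjoint_sdiff, Finset.union_sdiff_self_eq_union]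
      exact Finset.sum_le_sum_of_subset_of_nonneg Finset.subset_union_right fun v _ _ => h0 v
    have h3 : (∑ v ∈ L \ B, x v) * n ≤ t * K₁ := by
      calc (∑ v ∈ L \ B, x v) * n = ∑ v ∈ L \ B, n * x v := by
            rw [Finset.sum_mul]
            exact Finset.sum_congr rfl fun v _ => mul_comm _ _
        _ ≤ ∑ v ∈ L \ B, K₁ :=
          Finset.sum_le_sum fun v hv => hout v (Finset.mem_sdiff.1 hv).2
        _ = (L \ B).card * K₁ := by rw [Finset.sum_const, nsmul_eq_mul]
        _ ≤ t * K₁ := by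
          gcongr
          exact (Finset.card_le_card Finset.sdiff_subset).trans hcard.le
    have h4 : (∑ v ∈ L \ B, x v) * n ≤ 1 / 16 * n := by linarith
    linarith [le_of_mul_le_mul_right h4 hn0]
  have hBsum : p - 1 / 4 ≤ ∑ v ∈ B, x v := by linarith
  have hBcard : B.card = p := by
    refine le_antisymm hBp (Nat.le_of_lt_succ ?_)
    have h2 : ∑ v ∈ B, x v ≤ B.card := by
      simpa using Finset.sum_le_sum fun v (_ : v ∈ B) => h1 v
    have h3 : (p : ℝ) < (B.card + 1 : ℕ) := by
      push_cast
      linarith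
    exact_mod_cast h3
  refine ⟨B, hBcard, fun b hb => ?_, fun w hw => ?_⟩
  · have hxb : 1 / 2 ≤ x b := by
      have h2 : ∑ v ∈ B.erase b, x v ≤ (B.erase b).card := by
        simpa using Finset.sum_le_sum fun v (_ : v ∈ B.erase b) => h1 v
      have h3 := Finset.add_sum_erase B x hb
      have h4 : ((B.erase b).card : ℝ) + 1 = p := by
        rw [← hBcard]
        exact_mod_cast Finset.card_erase_add_one hb
      linarith
    refine ⟨hxb, ?_⟩
    have h2 : ρ - α * rdeg G b ≤ 2 * K := by
      by_contra! h
      have h3 : 2 * K * (1 / 2) < (ρ - α * rdeg G b) * x b :=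
        mul_lt_mul h hxb (by norm_num) (by linarith)
      linarith [hnbr b]
    have h3 : (n : ℝ) - rdeg G b ≤ (2 * K + 2) / α := by
      rw [le_div_iff₀ hα0]
      linarith
    linarith
  · have : 0 ≤ (2 * K + 2) / α := by positivity
    linarith [hout w hw]

/-- Replacing `G` by the complete split graph on its hubs increases the quadratic form. -/
lemma quadratic_form_lt {α C : ℝ} (hα0 : 0 < α) (hα1 : α < 1) {n : ℕ}
    {G : SimpleGraph (Fin n)} {x : Fin n → ℝ} (h0 : ∀ i, 0 ≤ x i) {B : Finset (Fin n)}
    (hxB : ∀ b ∈ B, 1 / 2 ≤ x b) (hout : ∀ w ∉ B, x w ≤ C)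
    (hadj : ∀ v ∈ commonNbrs G B, ∀ w ∉ B, ¬ G.Adj v w)
    (hC : ((n : ℝ) - (commonNbrs G B).card) ^ 2 * C ^ 2 < α / 4) (hne : G ≠ splitGraph B) :
    (∑ i, ∑ j, if G.Adj i j then α * x i ^ 2 + (1 - α) * (x i * x j) else 0) <
      ∑ i, ∑ j, if (splitGraph B).Adj i j then α * x i ^ 2 + (1 - α) * (x i * x j) else 0 := by
  have h1α : 0 < 1 - α := sub_pos.2 hα1
  obtain ⟨b, hb, r, hbr, hnot⟩ : ∃ b ∈ B, ∃ r, b ≠ r ∧ ¬ G.Adj b r := by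
    by_contra! hall
    apply hne
    ext i j
    rw [splitGraph_adj]
    refine ⟨fun h => ⟨h.ne, ?_⟩, ?_⟩
    · by_contra! hij
      refine hadj i (Finset.mem_filter.2 ⟨Finset.mem_univ _, fun b hb => ?_⟩) j hij.2 h
      exact hall b hb i fun hbi => hij.1 (hbi ▸ hb)
    · rintro ⟨hij, hi | hj⟩
      · exact hall i hi j hij
      · exact (hall j hj i hij.symm).symm
  set R := (commonNbrs G B)ᶜ with hR
  have hRcard : (R.card : ℝ) = n - (commonNbrs G B).card := by
    rw [hR, Finset.card_compl, Fintype.card_fin, Nat.cast_sub]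
    simpa using Finset.card_le_univ (commonNbrs G B)
  have hterm : ∀ i j, (if G.Adj i j then α * x i ^ 2 + (1 - α) * (x i * x j) else 0) +
      ((if i = b then if j = r then α / 4 else 0 else 0) -
        if i ∈ R then if j ∈ R then C ^ 2 else 0 else 0) ≤
      if (splitGraph B).Adj i j then α * x i ^ 2 + (1 - α) * (x i * x j) else 0 := by
    intro i j
    have hi0 := h0 i
    have hj0 := h0 j
    have hij0 : 0 ≤ α * x i ^ 2 + (1 - α) * (x i * x j) := by positivity
    have hR0 : 0 ≤ if i ∈ R then if j ∈ R then C ^ 2 else 0 else 0 := by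
      split_ifs <;> positivity
    by_cases hS : (splitGraph B).Adj i j
    · rw [if_pos hS]
      by_cases hG : G.Adj i j
      · have : (if i = b then if j = r then α / 4 else 0 else 0) = 0 := by
          split_ifs with h h'
          · subst h h'
            exact absurd hG hnot
          all_goals rfl
        rw [if_pos hG, this]
        linarith
      · rw [if_neg hG]
        have : (if i = b then if j = r then α / 4 else 0 else 0) ≤
            α * x i ^ 2 + (1 - α) * (x i * x j) := by
          split_ifs with h h'
          · subst h
            have h2 := hxB i hb
            have h3 : (1 / 4 : ℝ) ≤ x i ^ 2 := by nlinarith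
            have h4 : 0 ≤ (1 - α) * (x i * x j) := by positivity
            nlinarith
          all_goals exact hij0
        linarith
    · rw [if_neg hS]
      have hS' := hS
      rw [splitGraph_adj] at hS'
      have : (if i = b then if j = r then α / 4 else 0 else 0) = 0 := by
        split_ifs with h h'
        · subst h h'
          exact absurd ⟨hbr, Or.inl hb⟩ hS'
        all_goals rfl
      rw [this]
      by_cases hG : G.Adj i j
      · have hiB : i ∉ B := fun h => hS' ⟨hG.ne, Or.inl h⟩
        have hjB : j ∉ B := fun h => hS' ⟨hG.ne, Or.inr h⟩
        have hiR : i ∈ R := Finset.mem_compl.2 fun h => hadj i h j hjB hG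
        have hjR : j ∈ R := Finset.mem_compl.2 fun h => hadj j h i hiB hG.symm
        rw [if_pos hG, if_pos hiR, if_pos hjR]
        have h2 : x i ^ 2 ≤ C ^ 2 := by
          have := hout i hiB
          gcongr
        have h3 : x i * x j ≤ C ^ 2 := by
          have := hout i hiB
          have := hout j hjB
          rw [sq]
          gcongr
          linarith
        nlinarith
      · rw [if_neg hG]
        linarith
  have hsum := Finset.sum_le_sum fun i (_ : i ∈ Finset.univ) =>
    Finset.sum_le_sum fun j (_ : j ∈ Finset.univ) => hterm i j
  simp only [Finset.sum_add_distrib, Finset.sum_sub_distrib] at hsum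
  have hb1 : (∑ i, ∑ j, if i = b then if j = r then α / 4 else 0 else 0) = α / 4 := by
    rw [Finset.sum_eq_single b (fun i _ hi => by simp [hi]) (by simp)]
    simp
  have hR1 : (∑ i, ∑ j, if i ∈ R then if j ∈ R then C ^ 2 else 0 else 0) =
      (R.card : ℝ) ^ 2 * C ^ 2 := by
    have : ∀ i, (∑ j, if i ∈ R then if j ∈ R then C ^ 2 else 0 else 0) =
        if i ∈ R then (R.card : ℝ) * C ^ 2 else 0 := by
      intro i
      split_ifs <;> simp
    simp only [this, Finset.sum_ite_mem, Finset.univ_inter, Finset.sum_const, nsmul_eq_mul]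
    ring
  rw [hb1, hR1, hRcard] at hsum
  linarith

end PerronStructure

open LinearForest CompleteSplit PerronStructure in
/-- A graph free of the linear forest whose `A_α`-spectral radius is at least that of the complete
split graph is itself a complete split graph, provided it has enough vertices. -/
lemma eventually_eq_splitGraph {ℓ : ℕ} {k : Fin ℓ → ℕ} (hk : ∀ i, 2 ≤ k i) {p : ℕ}
    (hp : p + 1 = ∑ i, k i / 2) (hp1 : 1 ≤ p) (heven : ∃ i, Even (k i)) {α : ℝ} (hα0 : 0 < α)
    (hα1 : α < 1) : ∀ᶠ n : ℕ in Filter.atTop,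
      (∀ B : Finset (Fin n), B.card = p → rhoAlpha α (splitGraph B) = splitRadius α n p) ∧
      ∀ G : SimpleGraph (Fin n), ¬ ContainsLinearForest G k → splitRadius α n p ≤ rhoAlpha α G →
        ∃ B : Finset (Fin n), B.card = p ∧ G = splitGraph B := by
  have hδ : 0 < (1 - α) / (8 * α) := div_pos (sub_pos.2 hα1) (by positivity)
  obtain ⟨C, hC, hhubs⟩ := exists_hubs hα0 hα1 hp1 (∑ i, k i + 2)
  have hlarge : ∀ a b : ℝ, 0 < a → ∀ᶠ n : ℕ in Filter.atTop, b < a * (n : ℝ) := fun a b ha =>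
    (tendsto_natCast_atTop_atTop.const_mul_atTop ha).eventually_gt_atTop b
  filter_upwards [hhubs, eventually_le_splitRadius hα0 p hδ,
    hlarge α (α * p + α + (1 - α) / (8 * α) + 1) hα0, hlarge 1 (p * C + (∑ i, k i + 2 : ℕ)) one_pos,
    hlarge α (4 * (p * C * C) ^ 2) hα0, Filter.eventually_ge_atTop 1]
    with n hhubs hτ hn₁ hn₂ hn₃ hn
  have hp' : (1 : ℝ) ≤ p := by exact_mod_cast hp1
  have hn' : (1 : ℝ) ≤ n := by exact_mod_cast hn
  have hsplit : ∀ B : Finset (Fin n), B.card = p →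
      rhoAlpha α (splitGraph B) = splitRadius α n p := by
    intro B hB
    refine rhoAlpha_splitGraph hα0 hα1 hp1 hB hτ.2 ?_
    have h1 : 0 ≤ (1 - α) ^ 2 * p / α := by positivity
    have h2 : 0 ≤ (1 - α) * (p - 1) := mul_nonneg (by linarith) (by linarith)
    linarith [hτ.1]
  refine ⟨hsplit, fun G hG hρ => ?_⟩
  obtain ⟨x, h0, h1, hu, hx⟩ := AlphaSpectral.exists_perron_vector hα0.le hα1.le hn G
  obtain ⟨B, hB, hin, hout⟩ := hhubs G
    (fun B hB => card_commonNbrs_lt_of_free hk hp heven hG hB) _ x h0 h1 hu hx (hτ.1.trans hρ)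
  refine ⟨B, hB, ?_⟩
  by_contra hne
  have hR : (n : ℝ) - (commonNbrs G B).card ≤ p * C := by
    have h2 := le_card_commonNbrs G B
    have h3 : ∑ b ∈ B, ((n : ℝ) - rdeg G b) ≤ ∑ b ∈ B, C :=
      Finset.sum_le_sum fun b hb => (hin b hb).2
    rw [Finset.sum_const, hB, nsmul_eq_mul] at h3
    linarith
  have hR0 : 0 ≤ (n : ℝ) - (commonNbrs G B).card := by
    have := Finset.card_le_univ (commonNbrs G B)
    rw [Fintype.card_fin] at this
    exact sub_nonneg.2 (by exact_mod_cast this)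
  have hM : ∑ i, k i + 2 ≤ (commonNbrs G B).card := by
    have : ((∑ i, k i + 2 : ℕ) : ℝ) ≤ (commonNbrs G B).card := by linarith
    exact_mod_cast this
  have hbound : ((n : ℝ) - (commonNbrs G B).card) ^ 2 * (C / n) ^ 2 < α / 4 := by
    have h2 : ((n : ℝ) - (commonNbrs G B).card) ^ 2 * (C / n) ^ 2 ≤ (p * C) ^ 2 * (C / n) ^ 2 := by
      gcongr
    have h3 : ((p : ℝ) * C) ^ 2 * (C / n) ^ 2 = (p * C * C) ^ 2 / n ^ 2 := by
      field_simp
    refine h2.trans_lt ?_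
    rw [h3, div_lt_iff₀ (by positivity)]
    have h4 : α * n * 1 ≤ α * n * n := by gcongr
    linarith
  have hlt := quadratic_form_lt hα0 hα1 h0 (fun b hb => (hin b hb).1)
    (fun w hw => (le_div_iff₀' (by linarith)).2 (hout w hw))
    (fun v hv w hw => not_adj_of_free hk hp heven hG hB hM hv hw) hbound hne
  have hform : (∑ i, ∑ j, if G.Adj i j then α * x i ^ 2 + (1 - α) * (x i * x j) else 0) =
      rhoAlpha α G * ∑ i, x i ^ 2 := by
    rw [Finset.mul_sum]
    refine Finset.sum_congr rfl fun i _ => ?_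
    rw [show rhoAlpha α G * x i ^ 2 = rhoAlpha α G * x i * x i by ring, ← hx i, Finset.sum_mul]
    refine Finset.sum_congr rfl fun j _ => ?_
    split_ifs <;> ring
  have hle := AlphaSpectral.sum_alphaMat_le α (splitGraph B) x
  rw [hsplit B hB] at hle
  rw [hform] at hlt
  exact absurd (lt_of_mul_lt_mul_right (hlt.trans_le hle) (by positivity)) (not_lt.2 hρ)

theorem rhoAlpha_le_of_linearForest_free_even (ℓ : ℕ) (hℓ : 1 ≤ ℓ) (k : Fin ℓ → ℕ) (hk : ∀ i, 2 ≤ k i) (hmono : Antitone k)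
    (p : ℕ) (hp : p + 1 = ∑ i, k i / 2) (hp1 : 1 ≤ p)
    (heven : ∃ i, Even (k i)) (α : ℝ) (hα : α ∈ Set.Ioo (0 : ℝ) 1) :
    ∃ N : ℕ, ∀ n : ℕ, N ≤ n → ∀ G : SimpleGraph (Fin n), ¬ ContainsLinearForest G k →
      rhoAlpha α G ≤ (α * (n : ℝ) + (p : ℝ) - 1 +
          Real.sqrt ((α * (n : ℝ) + (p : ℝ) - 1) ^ 2 - 4 * (p : ℝ) * (2 * α - 1) * (n : ℝ) -
            4 * (p : ℝ) * ((p : ℝ) - ((p : ℝ) + 1) * α))) / 2 ∧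
      (rhoAlpha α G = (α * (n : ℝ) + (p : ℝ) - 1 +
          Real.sqrt ((α * (n : ℝ) + (p : ℝ) - 1) ^ 2 - 4 * (p : ℝ) * (2 * α - 1) * (n : ℝ) -
            4 * (p : ℝ) * ((p : ℝ) - ((p : ℝ) + 1) * α))) / 2 ↔ Nonempty (G ≃g Snp n p)) := by
  obtain ⟨N, hN⟩ := Filter.eventually_atTop.1
    (eventually_eq_splitGraph hk hp hp1 heven hα.1 hα.2)
  refine ⟨max N p, fun n hn G hG => ?_⟩
  obtain ⟨hsplit, hmain⟩ := hN n ((le_max_left _ _).trans hn)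
  have hiff : rhoAlpha α G = CompleteSplit.splitRadius α n p ↔ Nonempty (G ≃g Snp n p) := by
    rw [CompleteSplit.nonempty_iso_Snp_iff ((le_max_right _ _).trans hn)]
    refine ⟨fun h => hmain G hG h.ge, ?_⟩
    rintro ⟨B, hB, rfl⟩
    exact hsplit B hB
  refine ⟨?_, hiff⟩
  by_contra! hlt
  obtain ⟨B, hB, rfl⟩ := hmain G hG hlt.le
  exact hlt.ne' (hsplit B hB)
end

section
/- Let F_ℓ = P_{k_1} ∪ ⋯ ∪ P_{k_ℓ} be a linear forest with ℓ ≥ 1, k_1 ≥ ⋯ ≥ k_ℓ ≥ 2, and p = (∑_{i=1}^{ℓ} ⌊k_i/2⌋) − 1 ≥ 1, and suppose all k_i are odd and at least one k_i > 3. Then there exists N such that for all n ≥ N, every F_ℓ-free simple graph G on n vertices satisfies q(G) ≤ x₀, where x₀ is the largest real root of g(x) = 0 with g(x) = x³ − (n + 3p)x² + (4p² + np + 2n − 4)x − 2p²(p+1); equality holds if and only if G is isomorphic to S⁺_{n,p}. -/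
open SimpleGraph
open scoped Classical

section Spectral

variable {V : Type*} [Fintype V]

/-- The signless Laplacian of `G` applied to the vector `z`, at the vertex `u`. -/
noncomputable def qAct (G : SimpleGraph V) (z : V → ℝ) (u : V) : ℝ :=
  ∑ v, if G.Adj u v then z u + z v else 0

/-- Twice the quadratic form of the signless Laplacian, as a sum over ordered pairs. -/
noncomputable def qForm (G : SimpleGraph V) (z : V → ℝ) : ℝ :=
  ∑ u, ∑ v, if G.Adj u v then (z u + z v) ^ 2 else 0

lemma two_mul_sum_mul_qAct (G : SimpleGraph V) (z : V → ℝ) :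
    2 * ∑ u, z u * qAct G z u = qForm G z := by
  have h1 : ∑ u, z u * qAct G z u
      = ∑ u, ∑ v, if G.Adj u v then z u * (z u + z v) else 0 := by
    simp only [qAct, Finset.mul_sum, mul_ite, mul_zero]
  have h2 : ∑ u, z u * qAct G z u
      = ∑ u, ∑ v, if G.Adj u v then z v * (z u + z v) else 0 := by
    rw [h1, Finset.sum_comm]
    refine Finset.sum_congr rfl fun u _ => Finset.sum_congr rfl fun v _ => ?_
    rw [G.adj_comm, add_comm (z v)]
  rw [two_mul]
  nth_rewrite 1 [h1]
  rw [h2, qForm, ← Finset.sum_add_distrib]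
  refine Finset.sum_congr rfl fun u _ => ?_
  rw [← Finset.sum_add_distrib]
  refine Finset.sum_congr rfl fun v _ => ?_
  split_ifs <;> ring

/-- A positive eigenvector bounds the quadratic form by its eigenvalue. -/
lemma qForm_le_of_pos_eigenvector (G : SimpleGraph V) {x : ℝ} {y : V → ℝ} (hy : ∀ v, 0 < y v)
    (hx : ∀ u, qAct G y u = x * y u) (z : V → ℝ) : qForm G z ≤ 2 * (x * ∑ u, z u ^ 2) := by
  have key : ∑ u, z u ^ 2 / y u * qAct G y u = x * ∑ u, z u ^ 2 := by
    rw [Finset.mul_sum]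
    refine Finset.sum_congr rfl fun u _ => ?_
    rw [hx]
    have := (hy u).ne'
    field_simp
  have h1 : ∑ u, z u ^ 2 / y u * qAct G y u
      = ∑ u, ∑ v, if G.Adj u v then z u ^ 2 / y u * (y u + y v) else 0 := by
    simp only [qAct, Finset.mul_sum, mul_ite, mul_zero]
  have h2 : ∑ u, z u ^ 2 / y u * qAct G y u
      = ∑ u, ∑ v, if G.Adj u v then z v ^ 2 / y v * (y u + y v) else 0 := by
    rw [h1, Finset.sum_comm]
    refine Finset.sum_congr rfl fun u _ => Finset.sum_congr rfl fun v _ => ?_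
    rw [G.adj_comm, add_comm (y v)]
  rw [← key, two_mul]
  nth_rewrite 1 [h1]
  rw [h2, qForm, ← Finset.sum_add_distrib]
  refine Finset.sum_le_sum fun u _ => ?_
  rw [← Finset.sum_add_distrib]
  refine Finset.sum_le_sum fun v _ => ?_
  split_ifs
  · have hu := hy u
    have hv := hy v
    have : z u ^ 2 / y u * (y u + y v) + z v ^ 2 / y v * (y u + y v) - (z u + z v) ^ 2
        = (z u * y v - z v * y u) ^ 2 / (y u * y v) := by
      field_simp
      ring
    have h0 : 0 ≤ (z u * y v - z v * y u) ^ 2 / (y u * y v) := by positivity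
    linarith
  · simp

end Spectral

lemma mulVec_eq_qAct {n : ℕ} (G : SimpleGraph (Fin n)) (z : Fin n → ℝ) (u : Fin n) :
    ((degMat G + adjMat G).mulVec z) u = qAct G z u := by
  have hcard : (Nat.card {j // G.Adj u j} : ℝ) = ∑ v, if G.Adj u v then (1 : ℝ) else 0 := by
    rw [Nat.card_eq_fintype_card, Fintype.card_subtype]
    simp
  rw [Matrix.add_mulVec, Pi.add_apply, degMat, Matrix.mulVec_diagonal, hcard, Finset.sum_mul]
  simp only [adjMat, Matrix.mulVec, dotProduct, Matrix.of_apply, qAct]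
  rw [← Finset.sum_add_distrib]
  refine Finset.sum_congr rfl fun v _ => ?_
  split_ifs <;> simp

lemma mem_spectrum_iff_exists_eigenvector {n : ℕ} (G : SimpleGraph (Fin n)) (x : ℝ) :
    x ∈ spectrum ℝ (degMat G + adjMat G) ↔
      ∃ z : Fin n → ℝ, z ≠ 0 ∧ ∀ u, qAct G z u = x * z u := by
  rw [← Matrix.spectrum_toLin', ← Module.End.hasEigenvalue_iff_mem_spectrum]
  constructor
  · intro h
    obtain ⟨z, hz⟩ := h.exists_hasEigenvector
    refine ⟨z, hz.2, fun u => ?_⟩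
    rw [← mulVec_eq_qAct, ← Matrix.toLin'_apply, hz.apply_eq_smul]
    rfl
  · rintro ⟨z, hz0, hz⟩
    refine Module.End.hasEigenvalue_of_hasEigenvector (x := z)
      ⟨Module.End.mem_eigenspace_iff.2 ?_, hz0⟩
    ext u
    rw [Matrix.toLin'_apply, mulVec_eq_qAct, hz]
    rfl

lemma qRad_mem_spectrum {n : ℕ} (G : SimpleGraph (Fin n)) (h : 0 < qRad G) :
    qRad G ∈ spectrum ℝ (degMat G + adjMat G) := by
  have hne : (spectrum ℝ (degMat G + adjMat G)).Nonempty := by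
    by_contra hcon
    rw [Set.not_nonempty_iff_eq_empty] at hcon
    rw [qRad, specRad, hcon, Real.sSup_empty] at h
    exact lt_irrefl _ h
  exact hne.csSup_mem (Matrix.finite_spectrum _)

/-- A positive eigenvector belongs to the spectral radius. -/
lemma qRad_eq_of_pos_eigenvector {n : ℕ} (hn : 0 < n) (G : SimpleGraph (Fin n)) {x : ℝ}
    {y : Fin n → ℝ} (hy : ∀ v, 0 < y v) (hx : ∀ u, qAct G y u = x * y u) : qRad G = x := by
  refine IsGreatest.csSup_eq ⟨?_, ?_⟩
  · rw [mem_spectrum_iff_exists_eigenvector]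
    refine ⟨y, fun h => ?_, hx⟩
    have := hy ⟨0, hn⟩
    rw [h] at this
    exact lt_irrefl _ this
  · intro μ hμ
    obtain ⟨z, hz0, hz⟩ := (mem_spectrum_iff_exists_eigenvector G μ).1 hμ
    have h1 := qForm_le_of_pos_eigenvector G hy hx z
    rw [← two_mul_sum_mul_qAct] at h1
    have h2 : ∑ u, z u * qAct G z u = μ * ∑ u, z u ^ 2 := by
      rw [Finset.mul_sum]
      refine Finset.sum_congr rfl fun u _ => ?_
      rw [hz]
      ring
    obtain ⟨i, hi⟩ := Function.ne_iff.1 hz0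
    have hpos : 0 < ∑ u, z u ^ 2 :=
      Finset.sum_pos' (fun u _ => sq_nonneg _) ⟨i, Finset.mem_univ _, by
        have : z i ≠ 0 := hi
        positivity⟩
    rw [h2] at h1
    exact le_of_mul_le_mul_right (by linarith) hpos

/-- A positive spectral radius has a nonnegative subeigenvector with largest entry `1`. -/
lemma exists_nonneg_subeigenvector {n : ℕ} (G : SimpleGraph (Fin n)) (h : 0 < qRad G)
    (hdeg : ∀ u, (∑ v, if G.Adj u v then (1 : ℝ) else 0) ≤ qRad G) :
    ∃ z : Fin n → ℝ, (∀ v, 0 ≤ z v) ∧ (∀ v, z v ≤ 1) ∧ (∃ u, z u = 1) ∧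
      ∀ u, qRad G * z u ≤ qAct G z u := by
  obtain ⟨w, hw0, hw⟩ := (mem_spectrum_iff_exists_eigenvector G _).1 (qRad_mem_spectrum G h)
  obtain ⟨i, hi⟩ := Function.ne_iff.1 hw0
  obtain ⟨u, -, hu⟩ := Finset.exists_max_image Finset.univ (fun v => |w v|) ⟨i, Finset.mem_univ _⟩
  have hupos : 0 < |w u| := lt_of_lt_of_le (abs_pos.2 hi) (hu i (Finset.mem_univ _))
  refine ⟨fun v => |w v| / |w u|, fun v => by positivity,
    fun v => (div_le_one hupos).2 (hu v (Finset.mem_univ _)), ⟨u, div_self hupos.ne'⟩, fun v => ?_⟩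
  have hsplit : ∀ y : Fin n → ℝ, qAct G y v
      = (∑ x, if G.Adj v x then (1 : ℝ) else 0) * y v + ∑ x, if G.Adj v x then y x else 0 := by
    intro y
    rw [qAct, Finset.sum_mul, ← Finset.sum_add_distrib]
    refine Finset.sum_congr rfl fun x _ => ?_
    split_ifs <;> simp
  have h1 := hw v
  rw [hsplit] at h1
  set d := ∑ x, if G.Adj v x then (1 : ℝ) else 0 with hd
  have h2 : (qRad G - d) * |w v| ≤ ∑ x, if G.Adj v x then |w x| else 0 := by
    rw [← abs_of_nonneg (sub_nonneg.2 (hdeg v)), ← abs_mul]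
    have : (qRad G - d) * w v = ∑ x, if G.Adj v x then w x else 0 := by linarith
    rw [this]
    refine (Finset.abs_sum_le_sum_abs _ _).trans (Finset.sum_le_sum fun x _ => ?_)
    split_ifs <;> simp
  rw [hsplit]
  have h3 : (∑ x, if G.Adj v x then |w x| / |w u| else 0)
      = (∑ x, if G.Adj v x then |w x| else 0) / |w u| := by
    rw [Finset.sum_div]
    refine Finset.sum_congr rfl fun x _ => ?_
    split_ifs <;> simp
  rw [h3]
  have h4 := div_le_div_of_nonneg_right h2 hupos.le
  have h5 : (qRad G - d) * |w v| / |w u| = qRad G * (|w v| / |w u|) - d * (|w v| / |w u|) := by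
    ring
  change qRad G * (|w v| / |w u|) ≤ _
  linarith

lemma le_greatest_root_gpoly {n p : ℕ} (hp : 1 ≤ p) (hn : 4 * p ^ 2 + 4 ≤ n) {x₀ : ℝ}
    (hx : IsGreatest {x : ℝ | gpoly n p x = 0} x₀) : (n : ℝ) + 2 * p - 5 / 2 ≤ x₀ := by
  have hp' : (1 : ℝ) ≤ p := by exact_mod_cast hp
  have hn' : 4 * (p : ℝ) ^ 2 + 4 ≤ n := by exact_mod_cast hn
  set t : ℝ := (n : ℝ) + 2 * p - 5 / 2 with ht
  have hneg : gpoly n p t ≤ 0 := by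
    have e : gpoly n p t = t * (-(1 / 2) * t + (2 * p ^ 2 - 3 / 2 * p + 1))
        - 2 * (p : ℝ) ^ 2 * (p + 1) := by
      have : (n : ℝ) = t - 2 * p + 5 / 2 := by rw [ht]; ring
      rw [gpoly, this]
      ring
    have h1 : t * (-(1 / 2) * t + (2 * (p : ℝ) ^ 2 - 3 / 2 * p + 1)) ≤ 0 := by
      apply mul_nonpos_of_nonneg_of_nonpos <;> nlinarith
    have h2 : 0 ≤ 2 * (p : ℝ) ^ 2 * (p + 1) := by positivity
    linarith
  have hpos : 0 ≤ gpoly n p (n + 3 * p + 1) := by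
    have e : gpoly n p (n + 3 * p + 1) = ((n + 3 * p + 1 : ℝ) ^ 2 - 2 * (p : ℝ) ^ 2 * (p + 1))
        + (4 * (p : ℝ) ^ 2 + n * p + 2 * n - 4) * (n + 3 * p + 1) := by
      rw [gpoly]
      ring
    have h1 : 0 ≤ (4 * (p : ℝ) ^ 2 + n * p + 2 * n - 4) * (n + 3 * p + 1) := by
      apply mul_nonneg <;> nlinarith
    have h2 : 2 * (p : ℝ) ^ 2 * (p + 1) ≤ (n + 3 * p + 1 : ℝ) ^ 2 := by
      have : 2 * (p : ℝ) ^ 2 ≤ n + 3 * p + 1 := by nlinarith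
      have h' : (p : ℝ) + 1 ≤ n + 3 * p + 1 := by nlinarith
      rw [sq (n + 3 * p + 1 : ℝ)]
      apply mul_le_mul this h' <;> positivity
    linarith
  have hcont : ContinuousOn (gpoly n p) (Set.Icc t (n + 3 * p + 1)) := by
    unfold gpoly
    fun_prop
  obtain ⟨r, hr, hr0⟩ := intermediate_value_Icc (by linarith) hcont ⟨hneg, hpos⟩
  exact hr.1.trans (hx.2 hr0)

section Join

variable {V : Type*}

/-- The join of a clique on `L` with the empty graph on the other vertices, plus the edge `ab`. -/
def cliqueJoinEdge (L : Finset V) (a b : V) : SimpleGraph V where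
  Adj u v := u ≠ v ∧ (u ∈ L ∨ v ∈ L ∨ ((u = a ∨ u = b) ∧ (v = a ∨ v = b)))
  symm := ⟨fun _ _ h => ⟨h.1.symm, by tauto⟩⟩
  loopless := ⟨fun _ h => h.1 rfl⟩

lemma exists_pos_eigenvector_cliqueJoinEdge [Fintype V] (L : Finset V) {a b : V} (hab : a ≠ b)
    (ha : a ∉ L) (hb : b ∉ L) (hp : 1 ≤ L.card) {x : ℝ} (hx : (L.card : ℝ) + 2 < x)
    (hg : gpoly (Fintype.card V) L.card x = 0) :
    ∃ y : V → ℝ, (∀ v, 0 < y v) ∧ ∀ u, qAct (cliqueJoinEdge L a b) y u = x * y u := by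
  set p : ℝ := (L.card : ℝ) with hpdef
  set n : ℝ := (Fintype.card V : ℝ) with hndef
  have hp' : (1 : ℝ) ≤ p := by rw [hpdef]; exact_mod_cast hp
  set β := p / (x - p - 2) with hβ
  set γ := p / (x - p) with hγ
  have hβe : β * (x - p - 2) = p := div_mul_cancel₀ _ (by linarith)
  have hγe : γ * (x - p) = p := div_mul_cancel₀ _ (by linarith)
  have hβpos : 0 < β := div_pos (by linarith) (by linarith)
  have hγpos : 0 < γ := div_pos (by linarith) (by linarith)
  have hmain : n + p - 2 + 2 * β + (n - p - 2) * γ = x := by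
    have h1 : 0 < (x - p) * (x - p - 2) := mul_pos (by linarith) (by linarith)
    refine mul_right_cancel₀ h1.ne' ?_
    have e1 : β * ((x - p) * (x - p - 2)) = p * (x - p) := by
      linear_combination (x - p) * hβe
    have e2 : γ * ((x - p) * (x - p - 2)) = p * (x - p - 2) := by
      linear_combination (x - p - 2) * hγe
    rw [gpoly] at hg
    linear_combination 2 * e1 + (n - p - 2) * e2 - hg
  let y : V → ℝ := fun v => γ + (if v ∈ L then 1 - γ else 0) + (if v = a then β - γ else 0)
    + (if v = b then β - γ else 0)
  have hyL : ∀ v ∈ L, y v = 1 := by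
    intro v hv
    have h1 : v ≠ a := fun h => ha (h ▸ hv)
    have h2 : v ≠ b := fun h => hb (h ▸ hv)
    simp [y, hv, h1, h2]
  have hya : y a = β := by simp [y, ha, hab]
  have hyb : y b = β := by simp [y, hb, hab.symm]
  have hyo : ∀ v, v ∉ L → v ≠ a → v ≠ b → y v = γ := by
    intro v h1 h2 h3
    simp [y, h1, h2, h3]
  have hysum : ∑ v, y v = n * γ + p * (1 - γ) + 2 * (β - γ) := by
    simp only [y, Finset.sum_add_distrib, Finset.sum_ite_eq', Finset.sum_const, Finset.mem_univ,
      if_true, Finset.sum_ite_mem, Finset.univ_inter, nsmul_eq_mul, Finset.card_univ]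
    ring
  have hLsum : ∀ c : ℝ, (∑ v, if v ∈ L then c + y v else 0) = p * (c + 1) := by
    intro c
    rw [Finset.sum_ite_mem, Finset.univ_inter, Finset.sum_congr rfl
      (fun v hv => by rw [hyL v hv]), Finset.sum_const, nsmul_eq_mul]
  refine ⟨y, fun v => ?_, fun u => ?_⟩
  · by_cases h1 : v ∈ L
    · rw [hyL v h1]; exact one_pos
    by_cases h2 : v = a
    · rw [h2, hya]; exact hβpos
    by_cases h3 : v = b
    · rw [h3, hyb]; exact hβpos
    rw [hyo v h1 h2 h3]; exact hγpos
  · by_cases hu : u ∈ L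
    · have : qAct (cliqueJoinEdge L a b) y u
          = ∑ v, ((1 + y v) - if v = u then 2 else 0) := by
        refine Finset.sum_congr rfl fun v _ => ?_
        by_cases h : v = u
        · subst h
          rw [if_neg (SimpleGraph.irrefl _), if_pos rfl, hyL v hu]
          norm_num
        · rw [if_pos ⟨fun h' => h h'.symm, Or.inl hu⟩, if_neg h, hyL u hu, sub_zero]
      rw [this, Finset.sum_sub_distrib, Finset.sum_add_distrib, hysum, hyL u hu,
        Finset.sum_ite_eq']
      simp only [Finset.sum_const, Finset.card_univ, nsmul_eq_mul, Finset.mem_univ, if_true]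
      linear_combination hmain
    · have hend : ∀ c d : V, d ∉ L → y c = β → y d = β →
          (∀ v, (cliqueJoinEdge L a b).Adj c v ↔ v ∈ L ∨ v = d) →
          qAct (cliqueJoinEdge L a b) y c = x * y c := by
        intro c d hd hyc hyd hadj
        have : qAct (cliqueJoinEdge L a b) y c
            = ∑ v, ((if v ∈ L then y c + y v else 0) + if v = d then y c + y d else 0) := by
          refine Finset.sum_congr rfl fun v _ => ?_
          rw [hadj]
          by_cases h : v = d
          · subst h
            simp [hd]
          · simp [h]
        rw [this, Finset.sum_add_distrib, hLsum, Finset.sum_ite_eq', if_pos (Finset.mem_univ _),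
          hyc, hyd]
        linear_combination -hβe
      by_cases h2 : u = a
      · subst h2
        refine hend u b hb hya hyb fun v => ?_
        simp only [cliqueJoinEdge]
        grind
      by_cases h3 : u = b
      · subst h3
        refine hend u a ha hyb hya fun v => ?_
        simp only [cliqueJoinEdge]
        grind
      have : qAct (cliqueJoinEdge L a b) y u = ∑ v, if v ∈ L then y u + y v else 0 := by
        refine Finset.sum_congr rfl fun v _ => ?_
        have : (cliqueJoinEdge L a b).Adj u v ↔ v ∈ L := by
          simp only [cliqueJoinEdge]
          grind
        simp only [this]
      rw [this, hLsum, hyo u hu h2 h3]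
      linear_combination -hγe

lemma nonempty_iso_cliqueJoinEdge [Fintype V] {L L' : Finset V} (hL : L.card = L'.card)
    {a b a' b' : V} (hab : a ≠ b) (ha : a ∉ L) (hb : b ∉ L) (hab' : a' ≠ b') (ha' : a' ∉ L')
    (hb' : b' ∉ L') : Nonempty (cliqueJoinEdge L a b ≃g cliqueJoinEdge L' a' b') := by
  let φ : V → V := fun v =>
    if h : v ∈ L then Finset.equivOfCardEq hL ⟨v, h⟩ else if v = a then a' else b'
  have hφL : ∀ v ∈ L, φ v ∈ L' := by
    intro v hv
    simp [φ, hv]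
  have hφa : φ a = a' := by simp [φ, ha]
  have hφb : φ b = b' := by simp [φ, hb, hab.symm]
  have hinjL : ∀ v ∈ L, ∀ w ∈ L, φ v = φ w → v = w := by
    intro v hv w hw h
    simp only [φ, dif_pos hv, dif_pos hw] at h
    simpa using (Finset.equivOfCardEq hL).injective (Subtype.ext h)
  have hinj : Set.InjOn φ (insert a (insert b L) : Finset V) := by
    intro v hv w hw h
    simp only [Finset.coe_insert, Set.mem_insert_iff, Finset.mem_coe] at hv hw
    grind
  obtain ⟨g, hg⟩ := Finset.exists_equiv_extend_of_card_eq (t := (Finset.univ : Finset V))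
    Finset.card_univ.symm (Finset.subset_univ _) hinj
  let e : V ≃ V := g.trans (Equiv.subtypeUnivEquiv Finset.mem_univ)
  have he : ∀ v ∈ insert a (insert b L), e v = φ v := fun v hv => hg v hv
  have hea : e a = a' := by rw [he a (by simp), hφa]
  have heb : e b = b' := by rw [he b (by simp), hφb]
  have himg : L.image e = L' := by
    refine Finset.eq_of_subset_of_card_le ?_ ?_
    · intro w hw
      obtain ⟨v, hv, rfl⟩ := Finset.mem_image.1 hw
      rw [he v (by simp [hv])]
      exact hφL v hv
    · rw [Finset.card_image_of_injective _ e.injective, hL]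
  have heL : ∀ v, e v ∈ L' ↔ v ∈ L := by
    intro v
    rw [← himg, Finset.mem_image]
    exact ⟨fun ⟨w, hw, h⟩ => e.injective h ▸ hw, fun h => ⟨v, h, rfl⟩⟩
  refine ⟨⟨e, ?_⟩⟩
  intro v w
  simp only [cliqueJoinEdge, heL, ← hea, ← heb, e.injective.eq_iff, ne_eq]

end Join

lemma SnpPlus_eq_cliqueJoinEdge {n p : ℕ} (h : p + 2 ≤ n) :
    SnpPlus n p = cliqueJoinEdge (Finset.univ.filter fun i : Fin n => i.val < p)
      ⟨n - 2, by omega⟩ ⟨n - 1, by omega⟩ := by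
  ext u v
  simp only [SnpPlus, SimpleGraph.fromRel_adj, cliqueJoinEdge, Finset.mem_filter,
    Finset.mem_univ, true_and, ne_eq, Fin.ext_iff]
  have := u.2
  have := v.2
  grind

lemma qRad_eq_of_iso_SnpPlus {n p : ℕ} (hp : 1 ≤ p) (h : p + 2 ≤ n) {x : ℝ}
    (hx : (p : ℝ) + 2 < x) (hg : gpoly n p x = 0) (G : SimpleGraph (Fin n))
    (e : G ≃g SnpPlus n p) : qRad G = x := by
  have hc : (Finset.univ.filter fun i : Fin n => i.val < p).card = p := by
    rw [Fin.card_filter_val_lt]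
    omega
  obtain ⟨y, hy, hyx⟩ := exists_pos_eigenvector_cliqueJoinEdge
    (Finset.univ.filter fun i : Fin n => i.val < p) (a := ⟨n - 2, by omega⟩)
    (b := ⟨n - 1, by omega⟩) (x := x) (by simp [Fin.ext_iff]; omega) (by simp; omega)
    (by simp; omega) (by rw [hc]; exact hp) (by rw [hc]; exact hx)
    (by rw [hc, Fintype.card_fin]; exact hg)
  rw [← SnpPlus_eq_cliqueJoinEdge h] at hyx
  refine qRad_eq_of_pos_eigenvector (by omega) G (y := y ∘ e) (fun v => hy _) fun u => ?_
  rw [Function.comp_apply, ← hyx, qAct, qAct, ← e.toEquiv.sum_comp fun v =>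
    if (SnpPlus n p).Adj (e u) v then y (e u) + y v else 0]
  refine Finset.sum_congr rfl fun v _ => ?_
  simp only [Function.comp_apply, RelIso.coe_fn_toEquiv, e.map_adj_iff]

section Forest

variable {V : Type*}

/-- If every nonempty vertex set has a vertex with at most `D` neighbours in it, then a vertex
set `S` spans at most `D * |S|` edges. -/
lemma sum_card_adj_le_of_degenerate (G : SimpleGraph V) (D : ℕ)
    (h : ∀ S : Finset V, S.Nonempty → ∃ v ∈ S, (S.filter (G.Adj v)).card ≤ D) (S : Finset V) :
    ∑ v ∈ S, (S.filter (G.Adj v)).card ≤ 2 * D * S.card := by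
  induction S using Finset.strongInduction with
  | H S ih =>
    rcases S.eq_empty_or_nonempty with rfl | hS
    · simp
    obtain ⟨v, hv, hd⟩ := h S hS
    have h1 := ih (S.erase v) (Finset.erase_ssubset hv)
    have h2 : ∀ u ∈ S.erase v, (S.filter (G.Adj u)).card
        ≤ ((S.erase v).filter (G.Adj u)).card + if G.Adj v u then 1 else 0 := by
      intro u _
      by_cases huv : G.Adj v u
      · rw [if_pos huv, Finset.filter_erase]
        have := Finset.pred_card_le_card_erase (s := S.filter (G.Adj u)) (a := v)
        omega
      · rw [if_neg huv, Finset.filter_erase, Finset.erase_eq_of_notMem]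
        · rfl
        · simp only [Finset.mem_filter, not_and]
          exact fun _ h' => huv h'.symm
    have h3 : (∑ u ∈ S.erase v, if G.Adj v u then 1 else 0) ≤ (S.filter (G.Adj v)).card := by
      rw [← Finset.card_filter]
      exact Finset.card_le_card (Finset.filter_subset_filter _ (Finset.erase_subset _ _))
    have h4 := Finset.sum_le_sum h2
    rw [Finset.sum_add_distrib] at h4
    rw [← Finset.add_sum_erase S _ hv]
    have h5 := Finset.card_erase_add_one hv
    have h6 : 2 * D * S.card = 2 * D * (S.erase v).card + 2 * D := by rw [← h5]; ring
    omega

/-- A vertex set inside which all degrees exceed `K` contains a path on `j + 1 ≤ K + 1` vertices. -/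
lemma exists_path_of_lt_card_adj (G : SimpleGraph V) {K : ℕ} {S : Finset V} (hS : S.Nonempty)
    (h : ∀ v ∈ S, K < (S.filter (G.Adj v)).card) (j : ℕ) (hj : j ≤ K) :
    ∃ f : ℕ → V, Set.InjOn f (Set.Iic j) ∧ (∀ i ≤ j, f i ∈ S) ∧
      ∀ i < j, G.Adj (f i) (f (i + 1)) := by
  induction j with
  | zero =>
    obtain ⟨v, hv⟩ := hS
    refine ⟨fun _ => v, fun a ha b hb _ => ?_, fun _ _ => hv, fun i hi => absurd hi (by omega)⟩
    simp only [Set.mem_Iic] at ha hb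
    omega
  | succ j ih =>
    obtain ⟨f, hinj, hmem, hadj⟩ := ih (by omega)
    have hcard : ((Finset.range (j + 1)).image f).card < (S.filter (G.Adj (f j))).card := by
      refine lt_of_le_of_lt Finset.card_image_le ?_
      rw [Finset.card_range]
      exact lt_of_le_of_lt hj (h _ (hmem j le_rfl))
    obtain ⟨w, hw, hwf⟩ := Finset.exists_mem_notMem_of_card_lt_card hcard
    rw [Finset.mem_filter] at hw
    have hne : ∀ i ≤ j, f i ≠ w := fun i hi hfi =>
      hwf (Finset.mem_image.2 ⟨i, Finset.mem_range.2 (by omega), hfi⟩)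
    refine ⟨fun i => if i ≤ j then f i else w, ?_, ?_, ?_⟩
    · intro a ha b hb hab
      simp only [Set.mem_Iic] at ha hb
      by_cases h1 : a ≤ j <;> by_cases h2 : b ≤ j <;> simp only [h1, h2, if_true, if_false] at hab
      · exact hinj h1 h2 hab
      · exact absurd hab (hne a h1)
      · exact absurd hab.symm (hne b h2)
      · omega
    · intro i _
      dsimp only
      split_ifs with h1
      · exact hmem i h1
      · exact hw.1
    · intro i hi
      by_cases h1 : i + 1 ≤ j
      · simpa [h1, show i ≤ j by omega] using hadj i (by omega)
      · obtain rfl : i = j := by omega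
        simpa using hw.2

/-- A graph without a given linear forest has linearly many edges. -/
lemma sum_card_adj_le_of_not_containsLinearForest [Fintype V] (G : SimpleGraph V) {ℓ : ℕ}
    {k : Fin ℓ → ℕ} (h : ¬ ContainsLinearForest G k) :
    ∑ v, (Finset.univ.filter (G.Adj v)).card ≤ 2 * (∑ i, k i) * Fintype.card V := by
  refine sum_card_adj_le_of_degenerate G _ ?_ Finset.univ
  intro S hS
  by_contra! hcon
  obtain ⟨f, hinj, -, hadj⟩ := exists_path_of_lt_card_adj G hS hcon _ le_rfl
  have hval : ∀ (i : Fin ℓ) (a b : Fin (k i)), a.val + 1 = b.val →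
      (finSigmaFinEquiv ⟨i, a⟩ : Fin _).val + 1 = (finSigmaFinEquiv ⟨i, b⟩ : Fin _).val := by
    intro i a b hab
    rw [finSigmaFinEquiv_apply, finSigmaFinEquiv_apply, ← hab]
    rfl
  have hstep : ∀ (i : Fin ℓ) (a b : Fin (k i)), a.val + 1 = b.val →
      G.Adj (f (finSigmaFinEquiv ⟨i, a⟩ : Fin _).val) (f (finSigmaFinEquiv ⟨i, b⟩ : Fin _).val) := by
    intro i a b hab
    rw [← hval i a b hab]
    exact hadj _ (Fin.is_lt _)
  refine h ⟨fun i a => f (finSigmaFinEquiv ⟨i, a⟩ : Fin _).val, ?_, ?_⟩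
  · intro x y hxy
    have := hinj (Set.mem_Iic.2 (Fin.is_lt _).le) (Set.mem_Iic.2 (Fin.is_lt _).le) hxy
    exact finSigmaFinEquiv.injective (Fin.ext this)
  · intro i a b hab
    rcases SimpleGraph.pathGraph_adj.1 hab with h1 | h1
    · exact hstep i a b h1
    · exact (hstep i b a h1).symm

/-- Embedding a linear forest into a graph containing the complete bipartite graph between `A`
and `W`: the vertices in `C` go to `A`, the others to `W`, and the edges of the forest avoiding
`C` lie in `T`, where the embedding is prescribed. -/
lemma containsLinearForest_of_cover (G : SimpleGraph V) {ℓ : ℕ} {k : Fin ℓ → ℕ} {A W : Finset V}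
    (hadj : ∀ a ∈ A, ∀ w ∈ W, G.Adj a w) (C T : Finset ((i : Fin ℓ) × Fin (k i)))
    (hC : C.card ≤ A.card) (hW : ∑ i, k i ≤ W.card)
    (φ : (i : Fin ℓ) × Fin (k i) → V) (hφ : Set.InjOn φ T) (hφW : ∀ x ∈ T, φ x ∈ W)
    (hCT : ∀ x ∈ T, x ∉ C)
    (hedge : ∀ (i : Fin ℓ) (a b : Fin (k i)), a.val + 1 = b.val →
      ((⟨i, a⟩ : (i : Fin ℓ) × Fin (k i)) ∈ C ∧ (⟨i, b⟩ : (i : Fin ℓ) × Fin (k i)) ∉ C) ∨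
      ((⟨i, a⟩ : (i : Fin ℓ) × Fin (k i)) ∉ C ∧ (⟨i, b⟩ : (i : Fin ℓ) × Fin (k i)) ∈ C) ∨
      ((⟨i, a⟩ : (i : Fin ℓ) × Fin (k i)) ∈ T ∧ (⟨i, b⟩ : (i : Fin ℓ) × Fin (k i)) ∈ T ∧
        G.Adj (φ ⟨i, a⟩) (φ ⟨i, b⟩))) :
    ContainsLinearForest G k := by
  have hcardX : Fintype.card ((i : Fin ℓ) × Fin (k i)) = ∑ i, k i := by simp
  obtain ⟨t, hTt, htW, htc⟩ := Finset.exists_subsuperset_card_eq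
    (s := T.image φ) (t := W) (n := Fintype.card ((i : Fin ℓ) × Fin (k i)))
    (fun w hw => by
      obtain ⟨x, hx, rfl⟩ := Finset.mem_image.1 hw
      exact hφW x hx)
    (Finset.card_image_le.trans (Finset.card_le_univ _)) (by rw [hcardX]; exact hW)
  obtain ⟨ψ, hψ⟩ := Finset.exists_equiv_extend_of_card_eq htc.symm hTt hφ
  obtain ⟨α⟩ : Nonempty (C ↪ A) :=
    Function.Embedding.nonempty_of_card_le (by simpa using hC)
  let F : (i : Fin ℓ) × Fin (k i) → V := fun x => if h : x ∈ C then α ⟨x, h⟩ else ψ x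
  have hFC : ∀ x ∈ C, F x ∈ A := fun x hx => by simp [F, hx]
  have hFW : ∀ x, x ∉ C → F x ∈ W := fun x hx => by
    simp only [F, hx, dif_neg, not_false_eq_true]
    exact htW (ψ x).2
  have hAW : ∀ a ∈ A, a ∉ W := fun a ha hw => G.irrefl (hadj a ha a hw)
  have hFT : ∀ x ∈ T, F x = φ x := fun x hx => by
    simp only [F, hCT x hx, dif_neg, not_false_eq_true]
    exact hψ x hx
  have hstep : ∀ (i : Fin ℓ) (a b : Fin (k i)), a.val + 1 = b.val →
      G.Adj (F ⟨i, a⟩) (F ⟨i, b⟩) := by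
    intro i a b hab
    rcases hedge i a b hab with ⟨h1, h2⟩ | ⟨h1, h2⟩ | ⟨h1, h2, h3⟩
    · exact hadj _ (hFC _ h1) _ (hFW _ h2)
    · exact (hadj _ (hFC _ h2) _ (hFW _ h1)).symm
    · rw [hFT _ h1, hFT _ h2]
      exact h3
  refine ⟨fun i a => F ⟨i, a⟩, ?_, ?_⟩
  · intro x y hxy
    change F x = F y at hxy
    by_cases hx : x ∈ C <;> by_cases hy : y ∈ C
    · simp only [F, dif_pos hx, dif_pos hy] at hxy
      simpa using α.injective (Subtype.ext hxy)
    · exact absurd (hxy ▸ hFW y hy) (hAW _ (hFC x hx))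
    · exact absurd (hxy ▸ hFW x hx) (hAW _ (hFC y hy))
    · simp only [F, dif_neg hx, dif_neg hy] at hxy
      exact ψ.injective (Subtype.ext hxy)
  · intro i a b hab
    rcases SimpleGraph.pathGraph_adj.1 hab with h1 | h1
    · exact hstep i a b h1
    · exact (hstep i b a h1).symm

/-- The vertices at odd positions of the paths of a linear forest. -/
def oddPositions {ℓ : ℕ} (k : Fin ℓ → ℕ) : Finset ((i : Fin ℓ) × Fin (k i)) :=
  Finset.univ.filter fun x => x.2.val % 2 = 1

lemma card_filter_fst_eq_oddPositions_le {ℓ : ℕ} (k : Fin ℓ → ℕ) (i : Fin ℓ) :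
    ((oddPositions k).filter fun x => x.1 = i).card ≤ k i / 2 := by
  rw [← Finset.card_range (k i / 2)]
  refine Finset.card_le_card_of_injOn (fun x => x.2.val / 2) ?_ ?_
  · rintro ⟨j, a⟩ hx
    simp only [oddPositions, Finset.coe_filter, Finset.mem_filter, Finset.mem_univ, true_and,
      Set.mem_ofPred_eq] at hx
    obtain ⟨h1, rfl⟩ := hx
    have := a.2
    simp only [Finset.coe_range, Set.mem_Iio]
    omega
  · rintro ⟨j, a⟩ hx ⟨j', b⟩ hy hab
    simp only [oddPositions, Finset.coe_filter, Finset.mem_filter, Finset.mem_univ, true_and,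
      Set.mem_ofPred_eq] at hx hy hab
    obtain ⟨h1, rfl⟩ := hx
    obtain ⟨h2, rfl⟩ := hy
    have : a = b := Fin.ext (by omega)
    rw [this]

lemma card_oddPositions_le {ℓ : ℕ} (k : Fin ℓ → ℕ) :
    (oddPositions k).card ≤ ∑ i, k i / 2 := by
  rw [Finset.card_eq_sum_card_fiberwise (f := fun x => x.1) (t := Finset.univ) (by simp)]
  exact Finset.sum_le_sum fun i _ => card_filter_fst_eq_oddPositions_le k i

/-- A complete bipartite graph with parts of sizes `∑ k i / 2` and `∑ k i` contains the forest. -/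
lemma containsLinearForest_of_card_le [Nonempty V] (G : SimpleGraph V) {ℓ : ℕ} {k : Fin ℓ → ℕ}
    {A W : Finset V} (hadj : ∀ a ∈ A, ∀ w ∈ W, G.Adj a w) (hA : ∑ i, k i / 2 ≤ A.card)
    (hW : ∑ i, k i ≤ W.card) : ContainsLinearForest G k := by
  refine containsLinearForest_of_cover G hadj (oddPositions k) ∅
    ((card_oddPositions_le k).trans hA) hW (fun _ => Classical.arbitrary V) (by simp) (by simp) (by simp) ?_
  intro i a b hab
  simp only [oddPositions, Finset.mem_filter, Finset.mem_univ, true_and]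
  omega

/-- A path on three vertices off a set of `∑ k i / 2 - 1` dominating vertices yields the forest. -/
lemma containsLinearForest_of_path_three (G : SimpleGraph V) {ℓ : ℕ} {k : Fin ℓ → ℕ}
    {A W : Finset V} (hadj : ∀ a ∈ A, ∀ w ∈ W, G.Adj a w) (hA : ∑ i, k i / 2 ≤ A.card + 1)
    (hW : ∑ i, k i ≤ W.card) {i₀ : Fin ℓ} (hi₀ : 3 ≤ k i₀) {x y z : V} (hx : x ∈ W) (hy : y ∈ W)
    (hz : z ∈ W) (hxz : x ≠ z) (hxy : G.Adj x y) (hyz : G.Adj y z) :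
    ContainsLinearForest G k := by
  have hmem : (⟨i₀, ⟨1, by omega⟩⟩ : (i : Fin ℓ) × Fin (k i)) ∈ oddPositions k := by
    simp [oddPositions]
  refine containsLinearForest_of_cover G hadj
    ((oddPositions k).erase ⟨i₀, ⟨1, by omega⟩⟩)
    (Finset.univ.filter fun q => q.1 = i₀ ∧ q.2.val < 3) ?_ hW
    (fun q => if q.2.val = 0 then x else if q.2.val = 1 then y else z) ?_ ?_ ?_ ?_
  · have := card_oddPositions_le k
    rw [Finset.card_erase_of_mem hmem]
    omega
  · rintro ⟨i, a⟩ ha ⟨j, b⟩ hb hab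
    simp only [Finset.coe_filter, Finset.mem_univ, true_and, Set.mem_ofPred_eq] at ha hb
    obtain ⟨rfl, ha⟩ := ha
    obtain ⟨rfl, hb⟩ := hb
    have h1 := hxy.ne
    have h2 := hyz.ne
    have : a = b := Fin.ext (by dsimp only at hab; grind)
    rw [this]
  · intro q _
    split_ifs <;> assumption
  · rintro ⟨i, a⟩ ha
    simp only [Finset.mem_filter, Finset.mem_univ, true_and] at ha
    obtain ⟨rfl, ha⟩ := ha
    simp only [oddPositions, Finset.mem_erase, Finset.mem_filter, Finset.mem_univ, true_and, ne_eq,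
      Sigma.mk.injEq, heq_eq_eq, Fin.ext_iff]
    omega
  · intro i a b hab
    by_cases hi : i = i₀
    · subst hi
      simp only [oddPositions, Finset.mem_erase, Finset.mem_filter, Finset.mem_univ, true_and,
        ne_eq, Sigma.mk.injEq, heq_eq_eq, Fin.ext_iff]
      by_cases h0 : a.val = 0
      · have hb : b.val = 1 := by omega
        simp [h0, hb, hxy]
      by_cases h1 : a.val = 1
      · have hb : b.val = 2 := by omega
        simp [h1, hb, hyz]
      omega
    · simp only [oddPositions, Finset.mem_erase, Finset.mem_filter, Finset.mem_univ, true_and,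
        ne_eq, Sigma.mk.injEq, hi, false_and, not_false_eq_true]
      omega

/-- Two disjoint edges off a set of `∑ k i / 2 - 1` dominating vertices yield the forest, if one
of its paths is of odd order at least five. -/
lemma containsLinearForest_of_two_edges (G : SimpleGraph V) {ℓ : ℕ} {k : Fin ℓ → ℕ}
    {A W : Finset V} (hadj : ∀ a ∈ A, ∀ w ∈ W, G.Adj a w) (hA : ∑ i, k i / 2 ≤ A.card + 1)
    (hW : ∑ i, k i ≤ W.card) {i₀ : Fin ℓ} (hi₀ : 3 < k i₀) (hodd : Odd (k i₀)) {x y z w : V}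
    (hx : x ∈ W) (hy : y ∈ W) (hz : z ∈ W) (hw : w ∈ W) (hxz : x ≠ z) (hxw : x ≠ w) (hyz : y ≠ z)
    (hyw : y ≠ w) (hxy : G.Adj x y) (hzw : G.Adj z w) : ContainsLinearForest G k := by
  obtain ⟨b₀, hb₀⟩ := hodd
  let C : Finset ((i : Fin ℓ) × Fin (k i)) := Finset.univ.filter fun q =>
    if q.1 = i₀ then q.2.val % 2 = 0 ∧ 0 < q.2.val ∧ q.2.val + 1 < k i₀ else q.2.val % 2 = 1
  refine containsLinearForest_of_cover G hadj C
    (Finset.univ.filter fun q => q.1 = i₀ ∧ (q.2.val < 2 ∨ k i₀ ≤ q.2.val + 2)) ?_ hW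
    (fun q => if q.2.val = 0 then x else if q.2.val = 1 then y else
      if q.2.val + 2 = k i₀ then z else w) ?_ ?_ ?_ ?_
  · have h1 : C.card + 1 ≤ ∑ i, k i / 2 := by
      have hfib : ∀ i, (C.filter fun q => q.1 = i).card + (if i = i₀ then 1 else 0) ≤ k i / 2 := by
        intro i
        by_cases hi : i = i₀
        · subst hi
          have : (C.filter fun q => q.1 = i).card ≤ (Finset.range (k i / 2 - 1)).card := by
            refine Finset.card_le_card_of_injOn (fun q => q.2.val / 2 - 1) ?_ ?_
            · rintro ⟨j, a⟩ hq
              simp only [C, Finset.coe_filter, Finset.mem_filter, Finset.mem_univ, true_and,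
                Set.mem_ofPred_eq] at hq
              obtain ⟨h1, rfl⟩ := hq
              simp only [if_true] at h1
              simp only [Finset.coe_range, Set.mem_Iio]
              omega
            · rintro ⟨j, a⟩ hq ⟨j', b⟩ hq' hab
              simp only [C, Finset.coe_filter, Finset.mem_filter, Finset.mem_univ, true_and,
                Set.mem_ofPred_eq] at hq hq' hab
              obtain ⟨h1, rfl⟩ := hq
              obtain ⟨h2, rfl⟩ := hq'
              simp only [if_true] at h1 h2
              have : a = b := Fin.ext (by omega)
              rw [this]
          rw [Finset.card_range] at this
          rw [if_pos rfl]
          omega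
        · rw [if_neg hi, add_zero]
          refine (Finset.card_le_card ?_).trans (card_filter_fst_eq_oddPositions_le k i)
          rintro ⟨j, a⟩ hq
          simp only [C, oddPositions, Finset.mem_filter, Finset.mem_univ, true_and] at hq ⊢
          obtain ⟨h1, rfl⟩ := hq
          rw [if_neg hi] at h1
          exact ⟨h1, rfl⟩
      have hsum := Finset.sum_le_sum fun i (_ : i ∈ Finset.univ) => hfib i
      rw [Finset.sum_add_distrib, Finset.sum_ite_eq', if_pos (Finset.mem_univ _),
        ← Finset.card_eq_sum_card_fiberwise (by simp)] at hsum
      exact hsum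
    omega
  · rintro ⟨i, a⟩ ha ⟨j, b⟩ hb hab
    simp only [Finset.coe_filter, Finset.mem_univ, true_and, Set.mem_ofPred_eq] at ha hb
    obtain ⟨rfl, ha⟩ := ha
    obtain ⟨rfl, hb⟩ := hb
    have h1 := hxy.ne
    have h2 := hzw.ne
    have := a.2
    have := b.2
    have : a = b := Fin.ext (by dsimp only at hab; grind)
    rw [this]
  · intro q _
    split_ifs <;> assumption
  · rintro ⟨i, a⟩ ha
    simp only [Finset.mem_filter, Finset.mem_univ, true_and] at ha
    obtain ⟨rfl, ha⟩ := ha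
    simp only [C, Finset.mem_filter, Finset.mem_univ, true_and, if_true]
    omega
  · intro i a b hab
    by_cases hi : i = i₀
    · subst hi
      simp only [C, Finset.mem_filter, Finset.mem_univ, true_and, if_true]
      have hblt := b.2
      by_cases h0 : a.val = 0
      · have hb : b.val = 1 := by omega
        simp [h0, hb, hxy]
      by_cases h1 : a.val + 2 = k i
      · have hb : b.val + 1 = k i := by omega
        have e1 : a.val ≠ 1 := by omega
        have e2 : b.val ≠ 0 := by omega
        have e3 : b.val ≠ 1 := by omega
        have e4 : b.val + 2 ≠ k i := by omega
        right
        right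
        refine ⟨by omega, by omega, ?_⟩
        rw [if_neg h0, if_neg e1, if_pos h1, if_neg e2, if_neg e3, if_neg e4]
        exact hzw
      omega
    · simp only [C, Finset.mem_filter, Finset.mem_univ, true_and, if_neg hi]
      omega

end Forest

section Comparison

variable {V : Type*} [Fintype V]

lemma qAct_eq (G : SimpleGraph V) (z : V → ℝ) (u : V) :
    qAct G z u = (Finset.univ.filter (G.Adj u)).card * z u + ∑ v, if G.Adj u v then z v else 0 := by
  rw [qAct, ← Finset.sum_boole, Finset.sum_mul, ← Finset.sum_add_distrib]
  refine Finset.sum_congr rfl fun v _ => ?_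
  split_ifs <;> simp

lemma card_adj_add_one_le (G : SimpleGraph V) (v : V) :
    (Finset.univ.filter (G.Adj v)).card + 1 ≤ Fintype.card V :=
  Finset.card_lt_univ_of_notMem (x := v) (by simp)

lemma sum_adj_le_sum_sub (G : SimpleGraph V) {z : V → ℝ} (h0 : ∀ v, 0 ≤ z v) (u : V) :
    (∑ v, if G.Adj u v then z v else 0) ≤ ∑ v, z v - z u := by
  rw [← Finset.sum_erase_eq_sub (Finset.mem_univ u), ← Finset.sum_filter]
  refine Finset.sum_le_sum_of_subset_of_nonneg (fun v hv => ?_) fun v _ _ => h0 v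
  simp only [Finset.mem_filter, Finset.mem_univ, true_and] at hv
  simpa using hv.ne'

/-- In a graph with at most `E * n / 2` edges, at most `p` vertices of degree close to `n` and
large signless Laplacian spectral radius, there are exactly `p` such vertices, and the leading
eigenvector concentrates on them. -/
lemma card_eq_and_bounds_of_subeigenvector (G : SimpleGraph V) {z : V → ℝ} {q E : ℝ} {p : ℕ}
    {L : Finset V} (h0 : ∀ v, 0 ≤ z v) (h1 : ∀ v, z v ≤ 1) {u : V} (hu : z u = 1)
    (hq : ∀ v, q * z v ≤ qAct G z v) (hp : 1 ≤ p) (hE0 : 0 ≤ E)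
    (hE : ∑ v, ((Finset.univ.filter (G.Adj v)).card : ℝ) ≤ E * Fintype.card V)
    (hqn : (Fintype.card V : ℝ) + 2 * p - 5 / 2 ≤ q)
    (hLdef : ∀ v, v ∉ L → Fintype.card V + 2 * (p + 1) * (Finset.univ.filter (G.Adj v)).card
      < 2 * (p + 1) * Fintype.card V)
    (hL : L.card ≤ p) {B : ℝ} (hB : B = 4 * (p + 1) * (p + 4 * (p + 1) * E))
    (hn1 : 2 * (p + 1) ≤ Fintype.card V) (hn2 : 8 * B * E + 1 ≤ Fintype.card V) :
    L.card = p ∧ (∀ l ∈ L, 1 / 2 ≤ z l) ∧ ∀ v, v ∉ L → z v ≤ B / Fintype.card V := by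
  set d : V → ℝ := fun v => ((Finset.univ.filter (G.Adj v)).card : ℝ) with hd
  set n : ℝ := (Fintype.card V : ℝ) with hn
  have hp' : (1 : ℝ) ≤ p := by exact_mod_cast hp
  have hL' : (L.card : ℝ) ≤ p := by exact_mod_cast hL
  have hn1' : 2 * ((p : ℝ) + 1) ≤ n := by rw [hn]; exact_mod_cast hn1
  have hnpos : 0 < n := by linarith
  have hB0 : 0 ≤ B := by rw [hB]; positivity
  have hd0 : ∀ v, 0 ≤ d v := fun v => Nat.cast_nonneg _
  have hdn : ∀ v, d v + 1 ≤ n := fun v => by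
    simp only [hd, hn]
    exact_mod_cast card_adj_add_one_le G v
  have hqd : ∀ v, (q - d v) * z v ≤ ∑ w, if G.Adj v w then z w else 0 := by
    intro v
    have := hq v
    rw [qAct_eq] at this
    simp only [hd]
    linarith
  have hadj1 : ∀ v, (∑ w, if G.Adj v w then z w else 0) ≤ d v := by
    intro v
    simp only [hd]
    rw [← Finset.sum_boole]
    refine Finset.sum_le_sum fun w _ => ?_
    split_ifs
    · exact h1 w
    · exact le_rfl
  have hgap : ∀ v, v ∉ L → n ≤ 4 * (p + 1) * (q - d v) := by
    intro v hv
    have := hLdef v hv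
    have h2 : n + 2 * ((p : ℝ) + 1) * d v < 2 * (p + 1) * n := by
      simp only [hd, hn]
      exact_mod_cast this
    have h3 : 4 * ((p : ℝ) + 1) * (q - d v) ≥ 4 * (p + 1) * (n - 1 / 2 - d v) := by
      apply mul_le_mul_of_nonneg_left <;> linarith
    linarith
  have hbound : ∀ v, v ∉ L → ∀ s, (∑ w, if G.Adj v w then z w else 0) ≤ s →
      z v ≤ 4 * (p + 1) * s / n := by
    intro v hv s hs
    rw [le_div_iff₀ hnpos]
    calc z v * n ≤ z v * (4 * (p + 1) * (q - d v)) :=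
          mul_le_mul_of_nonneg_left (hgap v hv) (h0 v)
      _ = 4 * (p + 1) * ((q - d v) * z v) := by ring
      _ ≤ 4 * (p + 1) * s := mul_le_mul_of_nonneg_left ((hqd v).trans hs) (by positivity)
  have hsplit : ∀ f : V → ℝ, ∑ v, f v = ∑ v ∈ L, f v + ∑ v ∈ Lᶜ, f v :=
    fun f => (Finset.sum_add_sum_compl L f).symm
  have hLz : ∑ v ∈ L, z v ≤ L.card := by
    simpa using Finset.sum_le_sum fun v (_ : v ∈ L) => h1 v
  have hdc : ∑ v ∈ Lᶜ, d v ≤ E * n :=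
    (Finset.sum_le_univ_sum_of_nonneg hd0).trans hE
  have hS : ∑ v, z v ≤ p + 4 * (p + 1) * E := by
    rw [hsplit]
    have : ∑ v ∈ Lᶜ, z v ≤ ∑ v ∈ Lᶜ, 4 * (p + 1) / n * d v := by
      refine Finset.sum_le_sum fun v hv => ?_
      refine (hbound v (Finset.mem_compl.1 hv) _ (hadj1 v)).trans_eq ?_
      ring
    rw [← Finset.mul_sum] at this
    have h2 : 4 * (p + 1) / n * ∑ v ∈ Lᶜ, d v ≤ 4 * (p + 1) / n * (E * n) :=
      mul_le_mul_of_nonneg_left hdc (by positivity)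
    have h3 : 4 * (p + 1) / n * (E * n) = 4 * (p + 1) * E := by field_simp
    linarith
  have hsmall : ∀ v, v ∉ L → z v ≤ B / n := by
    intro v hv
    have hs : (∑ w, if G.Adj v w then z w else 0) ≤ p + 4 * (p + 1) * E :=
      ((sum_adj_le_sum_sub G h0 v).trans (sub_le_self _ (h0 v))).trans hS
    rw [hB]
    exact hbound v hv _ hs
  have hdz : ∑ v ∈ Lᶜ, d v * z v ≤ B * E := by
    have h2 : ∑ v ∈ Lᶜ, d v * z v ≤ ∑ v ∈ Lᶜ, d v * (B / n) :=
      Finset.sum_le_sum fun v hv =>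
        mul_le_mul_of_nonneg_left (hsmall v (Finset.mem_compl.1 hv)) (hd0 v)
    rw [← Finset.sum_mul] at h2
    have h3 : (∑ v ∈ Lᶜ, d v) * (B / n) ≤ E * n * (B / n) :=
      mul_le_mul_of_nonneg_right hdc (by positivity)
    have h4 : E * n * (B / n) = B * E := by field_simp
    linarith
  have hswap : ∑ v, (∑ w, if G.Adj v w then z w else 0) = ∑ w, d w * z w := by
    rw [Finset.sum_comm]
    refine Finset.sum_congr rfl fun w _ => ?_
    simp only [hd]
    rw [← Finset.sum_boole, Finset.sum_mul]
    refine Finset.sum_congr rfl fun v _ => ?_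
    rw [G.adj_comm]
    split_ifs <;> simp
  have hqpos : n - 1 / 2 ≤ q := by linarith
  have hlight : q * ∑ v ∈ Lᶜ, z v ≤ q * ∑ v ∈ L, z v + 2 * B * E := by
    have e1 : q * ∑ v ∈ Lᶜ, z v ≤ ∑ v ∈ Lᶜ, d v * z v
        + ∑ v ∈ Lᶜ, ∑ w, if G.Adj v w then z w else 0 := by
      rw [Finset.mul_sum, ← Finset.sum_add_distrib]
      refine Finset.sum_le_sum fun v _ => ?_
      have := hqd v
      linarith
    have e2 : (∑ v ∈ Lᶜ, ∑ w, if G.Adj v w then z w else 0) ≤ ∑ w, d w * z w := by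
      rw [← hswap]
      refine Finset.sum_le_univ_sum_of_nonneg fun v => Finset.sum_nonneg fun w _ => ?_
      split_ifs
      · exact h0 w
      · exact le_rfl
    have e3 : ∑ v ∈ L, d v * z v ≤ q * ∑ v ∈ L, z v := by
      rw [Finset.mul_sum]
      refine Finset.sum_le_sum fun v _ => mul_le_mul_of_nonneg_right ?_ (h0 v)
      have := hdn v
      linarith
    rw [hsplit] at e2
    linarith
  have hlight' : ∑ v ∈ Lᶜ, z v ≤ ∑ v ∈ L, z v + 1 / 4 := by
    have : 8 * B * E ≤ q := by linarith
    by_contra! hcon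
    nlinarith
  have hLsum : (p : ℝ) - 1 / 2 < ∑ v ∈ L, z v := by
    have e1 := hqd u
    have e2 := sum_adj_le_sum_sub G h0 u
    rw [hsplit z] at e2
    rw [hu] at e1 e2
    have := hdn u
    linarith
  have hcard : L.card = p := by
    refine le_antisymm hL ?_
    have : (p : ℝ) < L.card + 1 := by linarith
    have : p < L.card + 1 := by exact_mod_cast this
    omega
  refine ⟨hcard, fun l hl => ?_, hsmall⟩
  have e1 : ∑ v ∈ L, z v = z l + ∑ v ∈ L.erase l, z v := (Finset.add_sum_erase L z hl).symm
  have e2 : ∑ v ∈ L.erase l, z v ≤ (L.erase l).card := by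
    simpa using Finset.sum_le_sum fun v (_ : v ∈ L.erase l) => h1 v
  have e3 : ((L.erase l).card : ℝ) + 1 = p := by
    rw [← hcard]
    exact_mod_cast Finset.card_erase_add_one hl
  linarith

/-- Comparing quadratic forms: `l v` is an edge of `H` only, and the edges of `G` not in `H` have
weight at most `c`. -/
lemma qForm_add_le (G H : SimpleGraph V) (z : V → ℝ) {c : ℝ} (hc : 0 ≤ c) {l v : V}
    (hG : ¬ G.Adj l v) (hH : H.Adj l v)
    (h : ∀ u w, G.Adj u w → ¬ H.Adj u w → (z u + z w) ^ 2 ≤ c) :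
    qForm G z + (z l + z v) ^ 2
      ≤ qForm H z + c * ∑ u, ((Finset.univ.filter (G.Adj u)).card : ℝ) := by
  have e1 : (z l + z v) ^ 2
      = ∑ u, ∑ w, if u = l then if w = v then (z l + z v) ^ 2 else 0 else 0 := by
    rw [Finset.sum_eq_single l (fun u _ hu => by simp [hu]) (by simp)]
    simp
  have e2 : c * ∑ u, ((Finset.univ.filter (G.Adj u)).card : ℝ)
      = ∑ u, ∑ w, if G.Adj u w then c else 0 := by
    rw [Finset.mul_sum]
    refine Finset.sum_congr rfl fun u _ => ?_
    rw [← Finset.sum_boole, Finset.mul_sum]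
    simp
  rw [e1, e2, qForm, qForm, ← Finset.sum_add_distrib, ← Finset.sum_add_distrib]
  refine Finset.sum_le_sum fun u _ => ?_
  rw [← Finset.sum_add_distrib, ← Finset.sum_add_distrib]
  refine Finset.sum_le_sum fun w _ => ?_
  by_cases hu : u = l ∧ w = v
  · obtain ⟨rfl, rfl⟩ := hu
    simp [hG, hH]
  · have hz : (if u = l then if w = v then (z l + z v) ^ 2 else 0 else 0) = 0 := by
      split_ifs <;> tauto
    rw [hz, add_zero]
    by_cases h1 : G.Adj u w <;> by_cases h2 : H.Adj u w
    · simpa [h1, h2] using hc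
    · simpa [h1, h2] using h u w h1 h2
    · simpa [h1, h2] using sq_nonneg _
    · simp [h1, h2]

end Comparison

section Main

variable {V : Type*} [Fintype V]

/-- A graph without the linear forest has few vertices of degree close to the order. -/
lemma card_heavy_le [Nonempty V] (G : SimpleGraph V) {ℓ : ℕ} {k : Fin ℓ → ℕ} {p : ℕ}
    (hp : p + 1 = ∑ i, k i / 2) (hG : ¬ ContainsLinearForest G k)
    (hn : 2 * ∑ i, k i ≤ Fintype.card V) :
    (Finset.univ.filter fun v => 2 * (p + 1) * Fintype.card V
      ≤ Fintype.card V + 2 * (p + 1) * (Finset.univ.filter (G.Adj v)).card).card ≤ p := by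
  by_contra! hcon
  obtain ⟨A, hAL, hA⟩ := Finset.exists_subset_card_eq (Nat.succ_le_of_lt hcon)
  refine hG (containsLinearForest_of_card_le G (A := A)
    (W := Finset.univ.filter fun w => ∀ a ∈ A, G.Adj a w) ?_ (by omega) ?_)
  · intro a ha w hw
    exact (Finset.mem_filter.1 hw).2 a ha
  · set n := Fintype.card V
    have hbi : (A.biUnion fun a => Finset.univ.filter fun w => ¬ G.Adj a w).card
        ≤ A.card * (n / (2 * (p + 1))) := by
      refine Finset.card_biUnion_le_card_mul _ _ _ fun a ha => ?_
      have h1 := (Finset.mem_filter.1 (hAL ha)).2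
      have h2 := Finset.card_filter_add_card_filter_not (s := (Finset.univ : Finset V)) (G.Adj a)
      rw [Finset.card_univ] at h2
      rw [Nat.le_div_iff_mul_le (by omega)]
      change _ + _ = n at h2
      nlinarith
    have hsub : (Finset.univ : Finset V) ⊆ (Finset.univ.filter fun w => ∀ a ∈ A, G.Adj a w)
        ∪ A.biUnion fun a => Finset.univ.filter fun w => ¬ G.Adj a w := by
      intro w _
      by_cases h : ∀ a ∈ A, G.Adj a w
      · exact Finset.mem_union_left _ (by simpa using h)
      · push Not at h
        obtain ⟨a, ha, haw⟩ := h
        exact Finset.mem_union_right _ (Finset.mem_biUnion.2 ⟨a, ha, by simpa using haw⟩)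
    have h3 := (Finset.card_le_card hsub).trans (Finset.card_union_le _ _)
    rw [Finset.card_univ] at h3
    change n ≤ _ at h3
    have h4 := Nat.mul_div_le n (2 * (p + 1))
    rw [hA] at hbi
    have h5 : 2 * ((p + 1) * (n / (2 * (p + 1)))) ≤ n := by rw [← mul_assoc]; exact h4
    have h6 : p.succ = p + 1 := rfl
    rw [h6] at hbi
    omega

/-- A forest-free graph with `p` dominating vertices and an edge off them is `S⁺`. -/
lemma eq_cliqueJoinEdge_of_dominating (G : SimpleGraph V) {ℓ : ℕ} {k : Fin ℓ → ℕ} {p : ℕ}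
    (hp : p + 1 = ∑ i, k i / 2) (hodd : ∀ i, Odd (k i)) (hbig : ∃ i, 3 < k i)
    (hG : ¬ ContainsLinearForest G k) {L : Finset V} (hL : L.card = p)
    (hn : p + ∑ i, k i ≤ Fintype.card V) (hdom : ∀ l ∈ L, ∀ v, v ≠ l → G.Adj l v) {a b : V}
    (ha : a ∉ L) (hb : b ∉ L) (hab : G.Adj a b) : G = cliqueJoinEdge L a b := by
  obtain ⟨i₀, hi₀⟩ := hbig
  have hadj : ∀ l ∈ L, ∀ w ∈ Lᶜ, G.Adj l w := fun l hl w hw =>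
    hdom l hl w fun h => Finset.mem_compl.1 hw (h ▸ hl)
  have hW : ∑ i, k i ≤ (Lᶜ : Finset V).card := by
    rw [Finset.card_compl]
    omega
  have hP3 : ∀ x y z, x ∉ L → y ∉ L → z ∉ L → x ≠ z → G.Adj x y → G.Adj y z → False :=
    fun x y z hx hy hz hxz hxy hyz => hG (containsLinearForest_of_path_three G hadj (by omega) hW
      hi₀.le (Finset.mem_compl.2 hx) (Finset.mem_compl.2 hy) (Finset.mem_compl.2 hz) hxz hxy hyz)
  have h2K : ∀ x y, x ∉ L → y ∉ L → x ≠ a → x ≠ b → y ≠ a → y ≠ b → G.Adj x y → False :=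
    fun x y hx hy hxa hxb hya hyb hxy => hG (containsLinearForest_of_two_edges G hadj (by omega) hW
      hi₀ (hodd i₀) (Finset.mem_compl.2 hx) (Finset.mem_compl.2 hy) (Finset.mem_compl.2 ha)
      (Finset.mem_compl.2 hb) hxa hxb hya hyb hxy hab)
  have hout : ∀ x y, x ∉ L → y ∉ L → G.Adj x y → x = a ∨ x = b := by
    intro x y hx hy hxy
    by_contra! hcon
    by_cases hya : y = a
    · exact hP3 x a b hx ha hb hcon.2 (hya ▸ hxy) hab
    by_cases hyb : y = b
    · exact hP3 x b a hx hb ha hcon.1 (hyb ▸ hxy) hab.symm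
    exact h2K x y hx hy hcon.1 hcon.2 hya hyb hxy
  ext x y
  constructor
  · intro hxy
    refine ⟨hxy.ne, ?_⟩
    by_cases hx : x ∈ L
    · exact Or.inl hx
    by_cases hy : y ∈ L
    · exact Or.inr (Or.inl hy)
    exact Or.inr (Or.inr ⟨hout x y hx hy hxy, hout y x hy hx hxy.symm⟩)
  · rintro ⟨hne, hx | hy | ⟨rfl | rfl, rfl | rfl⟩⟩
    · exact hdom x hx y hne.symm
    · exact (hdom y hy x hne).symm
    · exact absurd rfl hne
    · exact hab
    · exact hab.symm
    · exact absurd rfl hne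

/-- If the spectral radius of a forest-free graph of large order is at least the greatest root of
`gpoly`, then the graph is the join of a clique with an empty graph plus one edge. -/
lemma exists_eq_cliqueJoinEdge (G : SimpleGraph V) {ℓ : ℕ} {k : Fin ℓ → ℕ} {p : ℕ}
    (hp : p + 1 = ∑ i, k i / 2) (hp1 : 1 ≤ p) (hodd : ∀ i, Odd (k i)) (hbig : ∃ i, 3 < k i)
    (hG : ¬ ContainsLinearForest G k) {E B x₀ q : ℝ} (hE : E = 2 * (∑ i, k i : ℕ))
    (hB : B = 4 * (p + 1) * (p + 4 * (p + 1) * E))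
    (hn1 : 2 * (p + 1) ≤ Fintype.card V) (hn2 : 8 * B * E + 1 ≤ Fintype.card V)
    (hn3 : 16 * B ^ 2 * E + 1 ≤ Fintype.card V) (hn4 : 2 * ∑ i, k i ≤ Fintype.card V)
    (hn5 : p + ∑ i, k i ≤ Fintype.card V)
    (hx₀ : (Fintype.card V : ℝ) + 2 * p - 5 / 2 ≤ x₀) (hroot : gpoly (Fintype.card V) p x₀ = 0)
    (hqx : x₀ ≤ q) {z : V → ℝ} (h0 : ∀ v, 0 ≤ z v) (h1 : ∀ v, z v ≤ 1) {u : V} (hu : z u = 1)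
    (hq : ∀ v, q * z v ≤ qAct G z v) :
    ∃ (L : Finset V) (a b : V), L.card = p ∧ a ≠ b ∧ a ∉ L ∧ b ∉ L ∧ G = cliqueJoinEdge L a b := by
  have : Nonempty V := ⟨u⟩
  have hp' : (1 : ℝ) ≤ p := by exact_mod_cast hp1
  have hE0 : 0 ≤ E := by rw [hE]; positivity
  have hn1' : 2 * ((p : ℝ) + 1) ≤ Fintype.card V := by exact_mod_cast hn1
  have hnpos : (0 : ℝ) < Fintype.card V := by linarith
  have hEsum : ∑ v, ((Finset.univ.filter (G.Adj v)).card : ℝ) ≤ E * Fintype.card V := by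
    rw [hE]
    exact_mod_cast sum_card_adj_le_of_not_containsLinearForest G hG
  obtain ⟨L, hLdef⟩ : ∃ L : Finset V, L = Finset.univ.filter fun v => 2 * (p + 1) * Fintype.card V
      ≤ Fintype.card V + 2 * (p + 1) * (Finset.univ.filter (G.Adj v)).card := ⟨_, rfl⟩
  have hLp : L.card ≤ p := hLdef ▸ card_heavy_le G hp hG hn4
  obtain ⟨hL, hheavy, hlight⟩ := card_eq_and_bounds_of_subeigenvector G h0 h1 hu hq hp1 hE0 hEsum
    (hx₀.trans hqx) (fun v hv => by simpa [hLdef] using hv) hLp hB hn1 hn2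
  have hB0 : 0 ≤ B := by rw [hB]; positivity
  have hzpos : 0 < ∑ v, z v ^ 2 :=
    Finset.sum_pos' (fun v _ => sq_nonneg _) ⟨u, Finset.mem_univ _, by rw [hu]; norm_num⟩
  have hform : 2 * (x₀ * ∑ v, z v ^ 2) ≤ qForm G z := by
    rw [← two_mul_sum_mul_qAct, Finset.mul_sum]
    refine mul_le_mul_of_nonneg_left (Finset.sum_le_sum fun v _ => ?_) zero_le_two
    have e1 := mul_le_mul_of_nonneg_left (hq v) (h0 v)
    have e2 := mul_le_mul_of_nonneg_right hqx (sq_nonneg (z v))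
    nlinarith
  have hupper : ∀ a b, a ≠ b → a ∉ L → b ∉ L →
      qForm (cliqueJoinEdge L a b) z ≤ qForm G z := by
    intro a b hab ha hb
    obtain ⟨y, hy, hyx⟩ := exists_pos_eigenvector_cliqueJoinEdge L hab ha hb (x := x₀)
      (by omega) (by rw [hL]; linarith) (by rw [hL]; exact hroot)
    exact (qForm_le_of_pos_eigenvector _ hy hyx z).trans hform
  have hcompl : 1 < (Lᶜ : Finset V).card := by
    rw [Finset.card_compl]
    omega
  have hdom : ∀ l ∈ L, ∀ v, v ≠ l → G.Adj l v := by
    intro l hl v hvl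
    by_contra hlv
    obtain ⟨a, b, ha, hb, hab⟩ := Finset.one_lt_card_iff.1 hcompl
    rw [Finset.mem_compl] at ha hb
    have e1 := qForm_add_le G (cliqueJoinEdge L a b) z
      (c := (2 * (B / Fintype.card V)) ^ 2) (sq_nonneg _) hlv ⟨hvl.symm, Or.inl hl⟩ (by
        intro x y hxy hH
        have hx : x ∉ L := fun h => hH ⟨hxy.ne, Or.inl h⟩
        have hy : y ∉ L := fun h => hH ⟨hxy.ne, Or.inr (Or.inl h)⟩
        have := hlight x hx
        have := hlight y hy
        exact pow_le_pow_left₀ (add_nonneg (h0 x) (h0 y)) (by linarith) 2)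
    have e2 := hupper a b hab ha hb
    have e3 : (1 / 2) ^ 2 ≤ (z l + z v) ^ 2 :=
      pow_le_pow_left₀ (by norm_num) (by linarith [hheavy l hl, h0 v]) 2
    have e4 := mul_le_mul_of_nonneg_left hEsum (sq_nonneg (2 * (B / Fintype.card V)))
    have e5 : (2 * (B / Fintype.card V)) ^ 2 * (E * Fintype.card V)
        = 4 * B ^ 2 * E / Fintype.card V := by
      field_simp
      ring
    have e6 : 4 * B ^ 2 * E / Fintype.card V < (1 / 2) ^ 2 := by
      rw [div_lt_iff₀ hnpos]
      linarith
    linarith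
  by_cases hedge : ∃ a b, a ∉ L ∧ b ∉ L ∧ G.Adj a b
  · obtain ⟨a, b, ha, hb, hab⟩ := hedge
    exact ⟨L, a, b, hL, hab.ne, ha, hb,
      eq_cliqueJoinEdge_of_dominating G hp hodd hbig hG hL hn5 hdom ha hb hab⟩
  · push Not at hedge
    exfalso
    obtain ⟨a, ha, hza⟩ : ∃ a, a ∉ L ∧ 0 < z a := by
      by_contra! hcon
      have e1 : ∑ v, z v ≤ p := by
        rw [← Finset.sum_add_sum_compl L, ← hL]
        have e2 : ∑ v ∈ L, z v ≤ L.card := by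
          simpa using Finset.sum_le_sum fun v (_ : v ∈ L) => h1 v
        have e3 : ∑ v ∈ Lᶜ, z v ≤ 0 :=
          Finset.sum_nonpos fun v hv => hcon v (Finset.mem_compl.1 hv)
        linarith
      have e2 := sum_adj_le_sum_sub G h0 u
      have e3 := hq u
      have e4 : ((Finset.univ.filter (G.Adj u)).card : ℝ) + 1 ≤ Fintype.card V := by
        exact_mod_cast card_adj_add_one_le G u
      rw [qAct_eq] at e3
      rw [hu] at e2 e3
      linarith
    obtain ⟨b, hb, hba⟩ := Finset.exists_mem_ne hcompl a
    rw [Finset.mem_compl] at hb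
    have e1 := qForm_add_le G (cliqueJoinEdge L a b) z (c := 0) le_rfl (hedge a b ha hb)
      ⟨hba.symm, Or.inr (Or.inr ⟨Or.inl rfl, Or.inr rfl⟩)⟩ (by
        intro x y hxy hH
        have hx : x ∉ L := fun h => hH ⟨hxy.ne, Or.inl h⟩
        have hy : y ∉ L := fun h => hH ⟨hxy.ne, Or.inr (Or.inl h)⟩
        exact absurd hxy (hedge x y hx hy))
    have e2 := hupper a b hba.symm ha hb
    have e3 : 0 < (z a + z b) ^ 2 := by
      have := h0 b
      positivity
    linarith

end Main

theorem q_le_of_linearForest_free_odd (ℓ : ℕ) (hℓ : 1 ≤ ℓ) (k : Fin ℓ → ℕ) (hk : ∀ i, 2 ≤ k i) (hmono : Antitone k)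
    (p : ℕ) (hp : p + 1 = ∑ i, k i / 2) (hp1 : 1 ≤ p)
    (hodd : ∀ i, Odd (k i)) (hbig : ∃ i, 3 < k i) :
    ∃ N : ℕ, ∀ n : ℕ, N ≤ n → ∀ G : SimpleGraph (Fin n), ¬ ContainsLinearForest G k →
      ∀ x₀ : ℝ, IsGreatest {x : ℝ | gpoly n p x = 0} x₀ →
        qRad G ≤ x₀ ∧ (qRad G = x₀ ↔ Nonempty (G ≃g SnpPlus n p)) := by
  set K := ∑ i, k i with hK
  set E : ℝ := 2 * (K : ℕ) with hE
  set B : ℝ := 4 * (p + 1) * (p + 4 * (p + 1) * E) with hB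
  refine ⟨4 * p ^ 2 + 4 + 2 * (p + 1) + 2 * K + (⌈8 * B * E⌉₊ + 1) + (⌈16 * B ^ 2 * E⌉₊ + 1), ?_⟩
  intro n hn G hG x₀ hx₀
  have hpp : p ≤ p ^ 2 := Nat.le_self_pow two_ne_zero p
  have hp' : (1 : ℝ) ≤ p := by exact_mod_cast hp1
  have hnp : ((4 * p ^ 2 + 4 : ℕ) : ℝ) ≤ n := by exact_mod_cast (by omega : 4 * p ^ 2 + 4 ≤ n)
  have hnp2 : ((2 * (p + 1) : ℕ) : ℝ) ≤ n := by exact_mod_cast (by omega : 2 * (p + 1) ≤ n)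
  push_cast at hnp hnp2
  have hlow := le_greatest_root_gpoly hp1 (by omega) hx₀
  have hiso : Nonempty (G ≃g SnpPlus n p) → qRad G = x₀ := fun ⟨e⟩ =>
    qRad_eq_of_iso_SnpPlus hp1 (by omega) (by linarith) hx₀.1 G e
  have hmain : x₀ ≤ qRad G → Nonempty (G ≃g SnpPlus n p) := by
    intro hq
    obtain ⟨z, h0, h1, ⟨u, hu⟩, hz⟩ := exists_nonneg_subeigenvector G (by linarith) fun u => by
      have hdeg := card_adj_add_one_le G u
      rw [Fintype.card_fin] at hdeg
      have hdeg' : ((Finset.univ.filter (G.Adj u)).card : ℝ) + 1 ≤ n := by exact_mod_cast hdeg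
      rw [Finset.sum_boole]
      linarith
    have hceil : ∀ r : ℝ, ⌈r⌉₊ + 1 ≤ n → r + 1 ≤ n := fun r hr =>
      (add_le_add_left (Nat.le_ceil r) 1).trans (by exact_mod_cast hr)
    obtain ⟨L, a, b, hL, hab, ha, hb, rfl⟩ := exists_eq_cliqueJoinEdge G hp hp1 hodd hbig hG hE hB
      (by rw [Fintype.card_fin]; omega) (by rw [Fintype.card_fin]; exact hceil _ (by omega))
      (by rw [Fintype.card_fin]; exact hceil _ (by omega)) (by rw [Fintype.card_fin]; omega)
      (by rw [Fintype.card_fin]; omega) (by rw [Fintype.card_fin]; exact hlow)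
      (by rw [Fintype.card_fin]; exact hx₀.1) hq h0 h1 hu hz
    rw [SnpPlus_eq_cliqueJoinEdge (by omega)]
    refine nonempty_iso_cliqueJoinEdge ?_ hab ha hb (by simp [Fin.ext_iff]; omega)
      (by simp; omega) (by simp; omega)
    rw [hL, Fin.card_filter_val_lt]
    omega
  refine ⟨?_, fun h => hmain h.ge, hiso⟩
  by_contra! hlt
  exact hlt.ne' (hiso (hmain hlt.le))
end
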